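/- arXiv:1203.3930 — 2 statements merged into one kernel-verified Lean document; each statement's English description precedes it below -/
import Mathlib

section
/- For every d, λ and positive integer M with λ ≤ d/(32(M+1)·log(9Md²)) there exists a constant C > 0, depending only on d and λ, such that the following holds: for every finite connected n-vertex (with n ≥ 3) d-regular λ-expander G and every vertex v₀ of G, the number of f ∈ Lip_{v₀}(G;M) satisfying max_{v ∈ V(G)} f(v) > C·M·log(log n) is at most |Lip_{v₀}(G;M)|/n². -/
/-- Number of pairs (a,b) ∈ S × T with {a,b} an edge of G. -/
def edgeCount {V : Type*} (G : SimpleGraph V) [DecidableRel G.Adj]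
    (S T : Finset V) : ℕ :=
  ((S ×ˢ T).filter (fun p => G.Adj p.1 p.2)).card

/-- `G` is an `n`-vertex `d`-regular `λ`-expander. -/
def IsExpander {V : Type*} [Fintype V] (G : SimpleGraph V) [DecidableRel G.Adj]
    (d : ℕ) (lam : ℝ) : Prop :=
  (∀ v : V, G.degree v = d) ∧
  ∀ S T : Finset V,
    |(edgeCount G S T : ℝ) - (d : ℝ) / (Fintype.card V : ℝ) * S.card * T.card| ≤
      lam * Real.sqrt ((S.card : ℝ) * T.card)

/-- `M`-Lipschitz functions on `G` vanishing at `v₀`. -/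
def LipSet {V : Type*} (G : SimpleGraph V) (v₀ : V) (M : ℕ) : Set (V → ℤ) :=
  {f | f v₀ = 0 ∧ ∀ u v : V, G.Adj u v → |f u - f v| ≤ (M : ℤ)}

open Finset

section WalkSupports

variable {α : Type*} [DecidableEq α]

/-- The supports of the walks of length `L` from `p`, where `nb q` lists the possible steps
from `q`. -/
def walkSupports (nb : α → Finset α) : ℕ → α → Finset (Finset α)
  | 0, p => {{p}}
  | L + 1, p => (nb p).biUnion fun q => (walkSupports nb L q).image (insert p)

lemma card_walkSupports_le {nb : α → Finset α} {D : ℕ} (hD : ∀ p, #(nb p) ≤ D) (L : ℕ) (p : α) :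
    #(walkSupports nb L p) ≤ D ^ L := by
  induction L generalizing p with
  | zero => simp [walkSupports]
  | succ L ih =>
    calc #(walkSupports nb (L + 1) p)
        ≤ #(nb p) * D ^ L :=
          card_biUnion_le_card_mul _ _ _ fun q _ => card_image_le.trans (ih q)
      _ ≤ D ^ (L + 1) := by rw [pow_succ']; exact Nat.mul_le_mul_right _ (hD p)

lemma mem_of_mem_walkSupports {nb : α → Finset α} {L : ℕ} {p : α} {Q : Finset α}
    (hQ : Q ∈ walkSupports nb L p) : p ∈ Q := by
  cases L with
  | zero => simp_all [walkSupports]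
  | succ L =>
    simp only [walkSupports, mem_biUnion, mem_image] at hQ
    obtain ⟨q, -, Q', -, rfl⟩ := hQ
    exact mem_insert_self _ _

lemma insert_mem_walkSupports {nb : α → Finset α} {L : ℕ} {p q : α} {Q : Finset α}
    (hq : q ∈ nb p) (hQ : Q ∈ walkSupports nb L q) : insert p Q ∈ walkSupports nb (L + 1) p := by
  simp only [walkSupports, mem_biUnion, mem_image]
  exact ⟨q, hq, Q, hQ, rfl⟩

/-- A detour `q → r → q` can be inserted into a walk. -/
lemma insert_detour_mem_walkSupports {nb : α → Finset α} {L : ℕ} {p q r : α} {Q : Finset α}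
    (hQ : Q ∈ walkSupports nb L p) (hq : q ∈ Q) (hqr : r ∈ nb q) (hrq : q ∈ nb r) :
    insert r Q ∈ walkSupports nb (L + 2) p := by
  have at_start : ∀ L, Q ∈ walkSupports nb L q → insert r Q ∈ walkSupports nb (L + 2) q := by
    intro L hQ
    have h := insert_mem_walkSupports hqr (insert_mem_walkSupports hrq hQ)
    rwa [insert_eq_of_mem (mem_insert_of_mem hq)] at h
  induction L generalizing p Q with
  | zero =>
    have hQ' := hQ
    simp only [walkSupports, mem_singleton] at hQ'
    subst hQ'
    obtain rfl := mem_singleton.1 hq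
    exact at_start 0 hQ
  | succ L ih =>
    by_cases hqp : q = p
    · subst hqp
      exact at_start _ hQ
    · simp only [walkSupports, mem_biUnion, mem_image] at hQ
      obtain ⟨p', hp', Q', hQ', rfl⟩ := hQ
      have hq' : q ∈ Q' := (mem_insert.1 hq).resolve_left hqp
      rw [insert_comm]
      refine insert_mem_walkSupports hp' (ih hQ' hq' fun L hL => ?_)
      have h := insert_mem_walkSupports hqr (insert_mem_walkSupports hrq hL)
      rwa [insert_eq_of_mem (mem_insert_of_mem hq')] at h

/-- A connected finite set is the support of a walk of length `2 * (#P - 1)`. -/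
lemma mem_walkSupports_of_connected {nb : α → Finset α} (hsymm : ∀ a b, a ∈ nb b → b ∈ nb a)
    {P : Finset α} {p : α} (hp : p ∈ P)
    (hconn : ∀ Q ⊆ P, p ∈ Q → Q ≠ P → ∃ q ∈ Q, ∃ r ∈ P \ Q, r ∈ nb q) :
    P ∈ walkSupports nb (2 * (#P - 1)) p := by
  have grow : ∀ j, j + 1 ≤ #P → ∃ Q ⊆ P, #Q = j + 1 ∧ Q ∈ walkSupports nb (2 * j) p := by
    intro j
    induction j with
    | zero => exact fun _ => ⟨{p}, by simpa using hp, by simp, by simp [walkSupports]⟩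
    | succ j ih =>
      intro hj
      obtain ⟨Q, hQP, hcard, hQ⟩ := ih (by omega)
      obtain ⟨q, hq, r, hr, hqr⟩ := hconn Q hQP (mem_of_mem_walkSupports hQ) (by
        rintro rfl
        omega)
      rw [mem_sdiff] at hr
      refine ⟨insert r Q, insert_subset hr.1 hQP, ?_, ?_⟩
      · rw [card_insert_of_notMem hr.2, hcard]
      · exact insert_detour_mem_walkSupports hQ hq hqr (hsymm _ _ hqr)
  have hpos : 0 < #P := card_pos.2 ⟨p, hp⟩
  obtain ⟨Q, hQP, hcard, hQ⟩ := grow (#P - 1) (by omega)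
  rwa [eq_of_subset_of_card_le hQP (by omega)] at hQ

end WalkSupports

lemma exists_finset_component {V : Type*} (r : V → V → Prop) (U : Finset V) {x : V} (hx : x ∈ U) :
    ∃ B ⊆ U, x ∈ B ∧ (∀ u ∈ B, ∀ w ∈ U, r u w → w ∈ B) ∧
      ∀ Q ⊆ B, x ∈ Q → Q ≠ B → ∃ q ∈ Q, ∃ w ∈ B, w ∉ Q ∧ r q w := by
  classical
  let R : V → V → Prop := fun a c => c ∈ U ∧ r a c
  refine ⟨U.filter (Relation.ReflTransGen R x), filter_subset _ _,
    mem_filter.2 ⟨hx, .refl⟩, ?_, ?_⟩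
  · intro u hu w hw huw
    exact mem_filter.2 ⟨hw, (mem_filter.1 hu).2.tail ⟨hw, huw⟩⟩
  · intro Q hQ hxQ hne
    by_contra! hclosed
    refine hne (hQ.antisymm fun u hu => ?_)
    have : ∀ u, Relation.ReflTransGen R x u → u ∈ Q := by
      intro u hu
      induction hu with
      | refl => exact hxQ
      | @tail a c hac hc ih =>
        by_contra hcQ
        exact hclosed a ih c (mem_filter.2 ⟨hc.1, hac.tail hc⟩) hcQ hc.2
    exact this u (mem_filter.1 hu).2

section Expansion

variable {V : Type*} [Fintype V] {G : SimpleGraph V} [DecidableRel G.Adj] {d : ℕ} {lam : ℝ}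

lemma IsExpander.pos (hG : IsExpander G d lam) (hd : 0 < d) (v : V) : 0 < lam := by
  have hn : (0 : ℝ) < Fintype.card V := by exact_mod_cast Fintype.card_pos_iff.2 ⟨v⟩
  have h := hG.2 {v} {v}
  have h0 : edgeCount G {v} {v} = 0 := by simp [edgeCount]
  have hpos : (0 : ℝ) < d / Fintype.card V := by positivity
  rw [h0] at h
  simp only [CharP.cast_eq_zero, card_singleton, Nat.cast_one, mul_one, zero_sub, abs_neg,
    Real.sqrt_one] at h
  exact hpos.trans_le ((le_abs_self _).trans h)

lemma IsExpander.mul_card_mul_card_le (hG : IsExpander G d lam) (hd : 0 < d) (v : V)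
    {S T : Finset V} (hST : ∀ u ∈ S, ∀ w ∈ T, ¬ G.Adj u w) :
    (d * #S : ℝ) * (d * #T) ≤ (lam * Fintype.card V) ^ 2 := by
  have hn : (0 : ℝ) < Fintype.card V := by exact_mod_cast Fintype.card_pos_iff.2 ⟨v⟩
  have hlam := hG.pos hd v
  have h0 : edgeCount G S T = 0 := by
    simp only [edgeCount, card_eq_zero, filter_eq_empty_iff, mem_product, Prod.forall]
    exact fun u w h => hST u h.1 w h.2
  have h := hG.2 S T
  rw [h0, Nat.cast_zero, zero_sub, abs_neg] at h
  have h := (le_abs_self _).trans h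
  set q := √((#S : ℝ) * #T)
  have hq : q ^ 2 = (#S : ℝ) * #T := Real.sq_sqrt (by positivity)
  have hq0 : 0 ≤ q := Real.sqrt_nonneg _
  have h1 : (d : ℝ) / Fintype.card V * q ^ 2 ≤ lam * q := by rw [hq, ← mul_assoc]; exact h
  have h2 : (d : ℝ) * q ≤ lam * Fintype.card V := by
    rcases hq0.eq_or_lt with hz | hpos
    · rw [← hz]; simp; positivity
    · have : (d : ℝ) / Fintype.card V * q ≤ lam := by
        refine le_of_mul_le_mul_right ?_ hpos
        linarith [h1, sq q, mul_assoc ((d : ℝ) / Fintype.card V) q q]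
      rw [div_mul_eq_mul_div, div_le_iff₀ hn] at this
      exact this
  calc (d * #S : ℝ) * (d * #T) = (d * q) ^ 2 := by rw [mul_pow, hq]; ring
    _ ≤ _ := pow_le_pow_left₀ (by positivity) h2 2

variable [DecidableEq V] (G)

/-- The set of vertices with a neighbour in `S`. -/
def nbhd (S : Finset V) : Finset V := S.biUnion fun u => G.neighborFinset u

variable {G}

lemma mem_nbhd {S : Finset V} {w : V} : w ∈ nbhd G S ↔ ∃ u ∈ S, G.Adj u w := by
  simp [nbhd]

lemma edgeCount_nbhd (hreg : ∀ v, G.degree v = d) (S : Finset V) :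
    edgeCount G S (nbhd G S) = d * #S := by
  unfold edgeCount
  rw [card_filter, sum_product]
  have hrow : ∀ u ∈ S, (∑ w ∈ nbhd G S, if G.Adj u w then 1 else 0) = d := by
    intro u hu
    rw [← card_filter, ← hreg u, ← G.card_neighborFinset_eq_degree]
    congr 1
    ext w
    simp only [mem_filter, SimpleGraph.mem_neighborFinset, mem_nbhd, and_iff_right_iff_imp]
    exact fun h => ⟨u, hu, h⟩
  rw [sum_congr rfl hrow, sum_const, smul_eq_mul, mul_comm]

lemma card_nbhd_le (hreg : ∀ v, G.degree v = d) (S : Finset V) : #(nbhd G S) ≤ #S * d :=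
  card_biUnion_le_card_mul _ _ _ fun u _ => by
    rw [G.card_neighborFinset_eq_degree, hreg]

/-- A set whose neighbourhood covers at most half of the graph expands quadratically in `d / λ`. -/
lemma IsExpander.sq_mul_card_le (hG : IsExpander G d lam) {S : Finset V}
    (hS : 2 * #(nbhd G S) ≤ Fintype.card V) :
    (d : ℝ) ^ 2 * #S ≤ 4 * lam ^ 2 * #(nbhd G S) := by
  rcases S.eq_empty_or_nonempty with rfl | hne
  · simp; positivity
  have hn : (0 : ℝ) < Fintype.card V := by
    exact_mod_cast Fintype.card_pos_iff.2 ⟨hne.choose⟩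
  have hs : (0 : ℝ) < #S := by exact_mod_cast hne.card_pos
  have h := (le_abs_self _).trans (hG.2 S (nbhd G S))
  rw [edgeCount_nbhd hG.1] at h
  push_cast at h
  have hN : 2 * (#(nbhd G S) : ℝ) ≤ Fintype.card V := by exact_mod_cast hS
  set N : ℝ := ((#(nbhd G S) : ℕ) : ℝ)
  have hN0 : 0 ≤ N := Nat.cast_nonneg _
  have hhalf : (d : ℝ) / Fintype.card V * #S * N ≤ d * #S / 2 := by
    have : N / Fintype.card V ≤ 1 / 2 := by
      rw [div_le_iff₀ hn]; linarith
    calc (d : ℝ) / Fintype.card V * #S * N = d * #S * (N / Fintype.card V) := by ring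
      _ ≤ d * #S * (1 / 2) := by gcongr
      _ = _ := by ring
  have h2 : (d : ℝ) * #S ≤ 2 * (lam * √(#S * N)) := by linarith
  have h3 : ((d : ℝ) * #S) ^ 2 ≤ (2 * (lam * √(#S * N))) ^ 2 :=
    pow_le_pow_left₀ (by positivity) h2 2
  have h4 : (2 * (lam * √(#S * N))) ^ 2 = #S * (4 * lam ^ 2 * N) := by
    rw [mul_pow, mul_pow, Real.sq_sqrt (by positivity)]; ring
  rw [h4] at h3
  refine le_of_mul_le_mul_left ?_ hs
  calc (#S : ℝ) * (d ^ 2 * #S) = (d * #S) ^ 2 := by ring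
    _ ≤ _ := h3

lemma IsExpander.mul_card_le (hG : IsExpander G d lam) (hlam0 : 0 < lam) (hlamd : lam ≤ d)
    {S : Finset V} (hS : (d : ℝ) * #S ≤ 2 * lam * Fintype.card V) :
    (d : ℝ) * #S ≤ 4 * lam * #(nbhd G S) := by
  rcases le_or_gt (2 * #(nbhd G S)) (Fintype.card V) with h | h
  · have h1 := hG.sq_mul_card_le h
    refine le_of_mul_le_mul_left ?_ (hlam0.trans_le hlamd)
    have : (lam : ℝ) * (4 * lam * #(nbhd G S)) ≤ d * (4 * lam * #(nbhd G S)) := by gcongr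
    nlinarith
  · have h' : (Fintype.card V : ℝ) ≤ 2 * #(nbhd G S) := by exact_mod_cast h.le
    nlinarith

end Expansion

section Lipschitz

variable {V : Type*} [Fintype V] {G : SimpleGraph V} {d M : ℕ} {lam : ℝ}

lemma abs_le_of_mem_lipSet (hconn : G.Connected) {v₀ : V} {f : V → ℤ} (hf : f ∈ LipSet G v₀ M)
    (v : V) : |f v| ≤ M * Fintype.card V := by
  classical
  have hwalk : ∀ {u w : V} (p : G.Walk u w), |f u - f w| ≤ M * p.length := by
    intro u w p
    induction p with
    | nil => simp
    | @cons a b c hab p ih =>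
      have h := abs_sub_le (f a) (f b) (f c)
      have h' := hf.2 a b hab
      rw [SimpleGraph.Walk.length_cons]
      push_cast
      linarith
  obtain ⟨p, hp⟩ := hconn.exists_isPath v v₀
  have h := hwalk p
  rw [hf.1, sub_zero] at h
  have hlen : (p.length : ℤ) ≤ Fintype.card V := by exact_mod_cast hp.length_lt.le
  exact h.trans (by gcongr)

lemma finite_lipSet (hconn : G.Connected) (v₀ : V) : (LipSet G v₀ M).Finite := by
  classical
  refine (Fintype.piFinset fun _ : V =>
    Icc (-(M * Fintype.card V : ℤ)) (M * Fintype.card V)).finite_toSet.subset fun f hf => ?_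
  exact mem_coe.2 (Fintype.mem_piFinset.2 fun v =>
    mem_Icc.2 (abs_le.1 (abs_le_of_mem_lipSet hconn hf v)))

variable [DecidableRel G.Adj]

/-- Up to a `2λ/d` fraction of the vertices, a Lipschitz function takes only `M + 1` values. -/
lemma IsExpander.exists_ground_value (hG : IsExpander G d lam) (hd : 0 < d) (hlamd : lam < d)
    (v : V) {f : V → ℤ} (hf : ∀ u w, G.Adj u w → |f u - f w| ≤ M) :
    ∃ u₀, (d * #{w | f w < f u₀} : ℝ) ≤ lam * Fintype.card V ∧
      (d * #{w | f u₀ + M < f w} : ℝ) ≤ lam * Fintype.card V := by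
  classical
  have hn : (0 : ℝ) < Fintype.card V := by exact_mod_cast Fintype.card_pos_iff.2 ⟨v⟩
  have hlam := hG.pos hd v
  let heavy : Finset V := {u | lam * Fintype.card V < (d * #{w | f w ≤ f u} : ℝ)}
  have hheavy : heavy.Nonempty := by
    obtain ⟨u, -, hu⟩ := exists_max_image (univ : Finset V) f ⟨v, mem_univ v⟩
    refine ⟨u, mem_filter.2 ⟨mem_univ _, ?_⟩⟩
    rw [filter_true_of_mem fun w hw => hu w hw, card_univ]
    gcongr
  obtain ⟨u₀, hu₀, hmin⟩ := exists_min_image heavy f hheavy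
  refine ⟨u₀, ?_, ?_⟩
  · rcases (univ.filter fun w => f w < f u₀).eq_empty_or_nonempty with h | h
    · rw [h]; simp; positivity
    · obtain ⟨u, hu, hmax⟩ := exists_max_image _ f h
      by_contra! hcon
      have hsub : (univ.filter fun w => f w < f u₀) ⊆ univ.filter fun w => f w ≤ f u :=
        fun w hw => mem_filter.2 ⟨mem_univ _, hmax w hw⟩
      have : u ∈ heavy := by
        refine mem_filter.2 ⟨mem_univ _, hcon.trans_le ?_⟩
        gcongr
      exact absurd (hmin u this) (not_le.2 (mem_filter.1 hu).2)
  · have hprod := hG.mul_card_mul_card_le hd v (S := {w | f w ≤ f u₀}) (T := {w | f u₀ + M < f w})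
      (by
        intro u hu w hw hadj
        have h1 := (mem_filter.1 hu).2
        have h2 := (mem_filter.1 hw).2
        have h3 := (abs_le.1 (hf u w hadj)).1
        linarith)
    have h1 := (mem_filter.1 hu₀).2
    have h0 : 0 < lam * Fintype.card V := by positivity
    by_contra! hcon
    nlinarith

variable [DecidableEq V]

/-- Flattening: functions which agree on `B`, leave `[k, k + M]` on `B`, and stay in `[k, k + M]`
around `B`, are rare among all Lipschitz functions, because each value next to `B` has only `M`
options instead of `M + 1`. -/
lemma card_mul_pow_le_of_outlier {v₀ : V} {k : ℤ} {B : Finset V} {h : V → ℤ}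
    {L E : Finset (V → ℤ)} (hL : ∀ f, f ∈ L ↔ f ∈ LipSet G v₀ M) (hEL : E ⊆ L)
    (hh : ∀ f ∈ E, ∀ u ∈ B, f u = h u) (hout : ∀ u ∈ B, h u < k ∨ k + M < h u)
    (hbd : ∀ f ∈ E, ∀ w ∈ nbhd G B \ B, f w ∈ Icc k (k + M) ∧
      ∀ z, G.Adj w z → z ∈ B ∨ f z ∈ Icc k (k + M)) :
    #E * (M + 1) ^ #(nbhd G B \ B) ≤ #L * ((M + 2) * M ^ #(nbhd G B \ B)) := by
  set A := nbhd G B \ B with hA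
  let c : V → ℤ := fun w => if ∃ b ∈ B, G.Adj b w ∧ k + M < h b then k + 1 else k
  let Γ : Finset (V → ℤ) := Fintype.piFinset fun w => if w ∈ A then Icc k (k + M) else {0}
  let Δ : Finset (V → ℤ) :=
    Fintype.piFinset fun w => if w ∈ A then Icc (c w) (c w + M - 1) else {0}
  have hΓ : #Γ = (M + 1) ^ #A := by
    rw [Fintype.card_piFinset, ← prod_const, ← prod_subset (subset_univ A)]
    · refine prod_congr rfl fun w hw => ?_
      rw [if_pos hw, Int.card_Icc]; omega
    · intro w _ hw
      rw [if_neg hw, card_singleton]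
  have hΔ : #Δ = M ^ #A := by
    rw [Fintype.card_piFinset, ← prod_const, ← prod_subset (subset_univ A)]
    · refine prod_congr rfl fun w hw => ?_
      rw [if_pos hw, Int.card_Icc]; omega
    · intro w _ hw
      rw [if_neg hw, card_singleton]
  have hshift : #(insert 0 (Icc k (k + M))) ≤ M + 2 := by
    refine (card_insert_le _ _).trans ?_
    rw [Int.card_Icc]; omega
  let g : (V → ℤ) × (V → ℤ) → V → ℤ :=
    fun q w => if w ∈ B then k else if w ∈ A then q.2 w else q.1 w
  have hgB : ∀ q w, w ∈ B → g q w = k := fun q w hw => if_pos hw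
  have hgA : ∀ q w, w ∈ A → g q w = q.2 w := fun q w hw => by
    simp only [g]; rw [if_neg (mem_sdiff.1 hw).2, if_pos hw]
  have hgO : ∀ q w, w ∉ B → w ∉ A → g q w = q.1 w := fun q w h1 h2 => by
    simp only [g]; rw [if_neg h1, if_neg h2]
  have hΓA : ∀ γ ∈ Γ, ∀ w ∈ A, γ w ∈ Icc k (k + M) := by
    intro γ hγ w hw
    have := Fintype.mem_piFinset.1 hγ w
    rwa [if_pos hw] at this
  have hΓO : ∀ γ ∈ Γ, ∀ w ∉ A, γ w = 0 := by
    intro γ hγ w hw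
    have := Fintype.mem_piFinset.1 hγ w
    rw [if_neg hw] at this
    exact mem_singleton.1 this
  have hgIcc : ∀ q ∈ E ×ˢ Γ, ∀ w, w ∈ B ∨ w ∈ A → g q w ∈ Icc k (k + M) := by
    intro q hq w hw
    rw [mem_product] at hq
    by_cases hwB : w ∈ B
    · rw [hgB _ _ hwB, mem_Icc]; omega
    · rw [hgA _ _ (hw.resolve_left hwB)]
      exact hΓA _ hq.2 _ (hw.resolve_left hwB)
  have hgNear : ∀ q ∈ E ×ˢ Γ, ∀ w z, (w ∈ B ∨ w ∈ A) → G.Adj w z → g q z ∈ Icc k (k + M) := by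
    intro q hq w z hw hwz
    by_cases hz : z ∈ B ∨ z ∈ A
    · exact hgIcc q hq z hz
    · rw [not_or] at hz
      rcases hw with hw | hw
      · exact absurd (mem_sdiff.2 ⟨mem_nbhd.2 ⟨w, hw, hwz⟩, hz.1⟩) hz.2
      · rw [hgO _ _ hz.1 hz.2]
        exact ((hbd q.1 (mem_product.1 hq).1 w hw).2 z hwz).resolve_left hz.1
  have hgLip : ∀ q ∈ E ×ˢ Γ, ∀ u w, G.Adj u w → |g q u - g q w| ≤ M := by
    intro q hq u w huw
    have inside : ∀ a b : ℤ, a ∈ Icc k (k + M) → b ∈ Icc k (k + M) → |a - b| ≤ M := by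
      intro a b ha hb
      rw [mem_Icc] at ha hb
      rw [abs_le]; omega
    by_cases hu : u ∈ B ∨ u ∈ A
    · exact inside _ _ (hgIcc q hq u hu) (hgNear q hq u w hu huw)
    by_cases hw : w ∈ B ∨ w ∈ A
    · exact inside _ _ (hgNear q hq w u hw huw.symm) (hgIcc q hq w hw)
    rw [not_or] at hu hw
    rw [hgO _ _ hu.1 hu.2, hgO _ _ hw.1 hw.2]
    exact ((hL _).1 (hEL (mem_product.1 hq).1)).2 u w huw
  let Φ : (V → ℤ) × (V → ℤ) → (V → ℤ) × ℤ × (V → ℤ) := fun q =>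
    (fun w => g q w - g q v₀, g q v₀, fun w => if w ∈ A then q.1 w else 0)
  have hmaps : Set.MapsTo Φ (E ×ˢ Γ : Finset _)
      (L ×ˢ (insert 0 (Icc k (k + M)) ×ˢ Δ) : Finset _) := by
    intro q hq
    have hq' := mem_product.1 (mem_coe.1 hq)
    refine mem_coe.2 (mem_product.2 ⟨(hL _).2 ⟨sub_self _, fun u w huw => ?_⟩,
      mem_product.2 ⟨?_, ?_⟩⟩)
    · simpa [Φ] using hgLip q hq u w huw
    · by_cases hv : v₀ ∈ B ∨ v₀ ∈ A
      · exact mem_insert_of_mem (hgIcc q hq v₀ hv)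
      · rw [not_or] at hv
        simp only [Φ]
        rw [hgO _ _ hv.1 hv.2, ((hL _).1 (hEL hq'.1)).1]
        exact mem_insert_self _ _
    · refine Fintype.mem_piFinset.2 fun w => ?_
      simp only [Φ]
      by_cases hw : w ∈ A
      · rw [if_pos hw, if_pos hw]
        have hrange := mem_Icc.1 (hbd q.1 hq'.1 w hw).1
        have hlip := ((hL _).1 (hEL hq'.1)).2
        rw [mem_Icc]
        by_cases hc : ∃ b ∈ B, G.Adj b w ∧ k + M < h b
        · have hcw : c w = k + 1 := if_pos hc
          obtain ⟨b, hb, hbw, hlt⟩ := hc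
          have := abs_le.1 (hlip b w hbw)
          rw [hh _ hq'.1 b hb] at this
          omega
        · have hcw : c w = k := if_neg hc
          obtain ⟨b, hb, hbw⟩ := mem_nbhd.1 (mem_sdiff.1 hw).1
          have hlow := (hout b hb).resolve_right fun hlt => hc ⟨b, hb, hbw, hlt⟩
          have := abs_le.1 (hlip b w hbw)
          rw [hh _ hq'.1 b hb] at this
          omega
      · rw [if_neg hw, if_neg hw, mem_singleton]
  have hinj : Set.InjOn Φ (E ×ˢ Γ : Finset _) := by
    intro q hq q' hq' heq
    have hqm := mem_product.1 (mem_coe.1 hq)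
    have hqm' := mem_product.1 (mem_coe.1 hq')
    simp only [Φ, Prod.mk.injEq] at heq
    obtain ⟨h1, h2, h3⟩ := heq
    have hg : ∀ w, g q w = g q' w := by
      intro w
      have := congrFun h1 w
      simp only [h2] at this
      linarith
    refine Prod.ext (funext fun w => ?_) (funext fun w => ?_)
    · by_cases hwB : w ∈ B
      · rw [hh _ hqm.1 _ hwB, hh _ hqm'.1 _ hwB]
      by_cases hwA : w ∈ A
      · have := congrFun h3 w
        rwa [if_pos hwA, if_pos hwA] at this
      · have := hg w
        rwa [hgO _ _ hwB hwA, hgO _ _ hwB hwA] at this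
    · by_cases hwA : w ∈ A
      · have := hg w
        rwa [hgA _ _ hwA, hgA _ _ hwA] at this
      · rw [hΓO _ hqm.2 _ hwA, hΓO _ hqm'.2 _ hwA]
  have hcard := card_le_card_of_injOn Φ hmaps hinj
  rw [card_product, card_product, card_product, hΓ, hΔ] at hcard
  exact hcard.trans (by gcongr)

variable (G M) in
/-- The pairs `(w, a)` with `w` within two steps of `p.1` and `|a - p.2| ≤ 2 * M`. -/
noncomputable def jumpNbhd (p : V × ℤ) : Finset (V × ℤ) :=
  (nbhd G {p.1} ∪ nbhd G (nbhd G {p.1})) ×ˢ Icc (p.2 - 2 * M) (p.2 + 2 * M)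

lemma mem_two_step {u w : V} : w ∈ nbhd G {u} ∪ nbhd G (nbhd G {u}) ↔
    G.Adj u w ∨ ∃ z, G.Adj u z ∧ G.Adj z w := by
  simp [mem_nbhd]

lemma mem_jumpNbhd_symm (p q : V × ℤ) (h : p ∈ jumpNbhd G M q) : q ∈ jumpNbhd G M p := by
  simp only [jumpNbhd, mem_product, mem_two_step, mem_Icc] at h ⊢
  refine ⟨h.1.imp (·.symm) fun ⟨z, hz, hz'⟩ => ⟨z, hz'.symm, hz.symm⟩, ?_⟩
  omega

lemma card_jumpNbhd_le (hreg : ∀ v, G.degree v = d) (hd : 0 < d) (hM : 0 < M) (p : V × ℤ) :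
    #(jumpNbhd G M p) ≤ 10 * M * d ^ 2 := by
  have h1 := card_nbhd_le hreg {p.1}
  have h2 := card_nbhd_le hreg (nbhd G {p.1})
  rw [card_singleton, one_mul] at h1
  have h3 : #(nbhd G {p.1} ∪ nbhd G (nbhd G {p.1})) ≤ 2 * d ^ 2 := by
    refine (card_union_le _ _).trans ?_
    nlinarith
  have h4 : #(Icc (p.2 - 2 * M) (p.2 + 2 * M)) ≤ 5 * M := by
    rw [Int.card_Icc]; omega
  rw [jumpNbhd, card_product]
  calc _ ≤ (2 * d ^ 2) * (5 * M) := Nat.mul_le_mul h3 h4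
    _ = _ := by ring

variable (G) in
/-- `P` is the graph of `f` over a set of vertices where `f` leaves `[k, k + M]`, while
`f` stays in `[k, k + M]` around that set. -/
def IsOutlier (M : ℕ) (k : ℤ) (f : V → ℤ) (P : Finset (V × ℤ)) : Prop :=
  (∀ p ∈ P, f p.1 = p.2 ∧ (p.2 < k ∨ k + M < p.2)) ∧
  ∀ w ∈ nbhd G (P.image Prod.fst) \ P.image Prod.fst, f w ∈ Icc k (k + M) ∧
    ∀ z, G.Adj w z → z ∈ P.image Prod.fst ∨ f z ∈ Icc k (k + M)

lemma card_mul_pow_le_of_isOutlier {v₀ : V} {k : ℤ} {P : Finset (V × ℤ)}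
    {L E : Finset (V → ℤ)} (hL : ∀ f, f ∈ L ↔ f ∈ LipSet G v₀ M) (hEL : E ⊆ L)
    (hE : ∀ f ∈ E, IsOutlier G M k f P) :
    #E * (M + 1) ^ #(nbhd G (P.image Prod.fst) \ P.image Prod.fst) ≤
      #L * ((M + 2) * M ^ #(nbhd G (P.image Prod.fst) \ P.image Prod.fst)) := by
  rcases E.eq_empty_or_nonempty with rfl | ⟨h, hmem⟩
  · simp
  refine card_mul_pow_le_of_outlier (h := h) hL hEL ?_ ?_ fun f hf => (hE f hf).2
  · intro f hf u hu
    obtain ⟨p, hp, rfl⟩ := mem_image.1 hu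
    rw [((hE f hf).1 p hp).1, ((hE h hmem).1 p hp).1]
  · intro u hu
    obtain ⟨p, hp, rfl⟩ := mem_image.1 hu
    obtain ⟨h1, h2⟩ := (hE h hmem).1 p hp
    rwa [h1]

/-- A large deviation of `f` from the ground values forces a large outlier set with an even
larger boundary. -/
lemma IsExpander.exists_isOutlier (hG : IsExpander G d lam) (hd : 0 < d) {Λ : ℝ} (hΛ : 1 ≤ Λ)
    (hlam : 32 * (M + 1) * Λ * lam ≤ d) {f : V → ℤ} (hf : ∀ u w, G.Adj u w → |f u - f w| ≤ M)
    {k : ℤ} (hlow : (d * #{w | f w < k} : ℝ) ≤ lam * Fintype.card V)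
    (hhigh : (d * #{w | k + M < f w} : ℝ) ≤ lam * Fintype.card V) {x : V} {s : ℕ}
    (hx : f x < k - s * M ∨ k + M + s * M < f x) :
    ∃ P, IsOutlier G M k f P ∧ P ∈ walkSupports (jumpNbhd G M) (2 * (#P - 1)) (x, f x) ∧
      4 ^ s ≤ #P ∧ #P ≤ Fintype.card V ∧
      7 * (M + 1) * Λ * #P ≤ #(nbhd G (P.image Prod.fst) \ P.image Prod.fst) := by
  have hn : (0 : ℝ) < Fintype.card V := by exact_mod_cast Fintype.card_pos_iff.2 ⟨x⟩
  have hlam0 := hG.pos hd x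
  have hM0 : (0 : ℝ) ≤ M := Nat.cast_nonneg _
  have hMΛ : 1 ≤ (M + 1) * Λ := by nlinarith
  have hlamd : 32 * lam ≤ d := by nlinarith
  have hd' : (0 : ℝ) < d := by exact_mod_cast hd
  let U : Finset V := {w | f w < k ∨ k + M < f w}
  have hUcard : (d : ℝ) * #U ≤ 2 * lam * Fintype.card V := by
    have hle : (#U : ℝ) ≤ #{w | f w < k} + #{w | k + M < f w} := by
      simp only [U, filter_or]
      exact_mod_cast card_union_le _ _
    nlinarith
  have hmemU : ∀ w, w ∈ U ↔ f w < k ∨ k + M < f w := fun w => by simp [U]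
  have hnotU : ∀ w, w ∉ U → f w ∈ Icc k (k + M) := by
    intro w hw
    rw [hmemU, not_or, not_lt, not_lt] at hw
    exact mem_Icc.2 hw
  have hsM : (0 : ℤ) ≤ s * M := by positivity
  have hxU : x ∈ U := (hmemU x).2 (hx.imp (fun h => by linarith) fun h => by linarith)
  obtain ⟨B, hBU, hxB, hclosed, hconn⟩ :=
    exists_finset_component (fun u w => w ∈ nbhd G {u} ∪ nbhd G (nbhd G {u})) U hxU
  have hsmall : ∀ S ⊆ U, (d : ℝ) * #S ≤ 2 * lam * Fintype.card V := fun S hS => by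
    refine le_trans ?_ hUcard
    gcongr
  have hgrow : ∀ j ≤ s, ∃ A ⊆ B, 4 ^ j ≤ #A ∧
      ∀ w ∈ A, f w < k - (s - j) * M ∨ k + M + (s - j) * M < f w := by
    intro j
    induction j with
    | zero => exact fun _ => ⟨{x}, by simpa using hxB, by simp, by simpa using hx⟩
    | succ j ih =>
      intro hj
      obtain ⟨A, hAB, hcard, hA⟩ := ih (by omega)
      have hfar : ∀ w ∈ nbhd G A,
          f w < k - (s - (j + 1 : ℕ)) * M ∨ k + M + (s - (j + 1 : ℕ)) * M < f w := by
        intro w hw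
        obtain ⟨u, hu, huw⟩ := mem_nbhd.1 hw
        have h := abs_le.1 (hf u w huw)
        push_cast
        refine (hA u hu).imp (fun h' => ?_) fun h' => ?_ <;> linarith
      have hNB : nbhd G A ⊆ B := by
        intro w hw
        obtain ⟨u, hu, huw⟩ := mem_nbhd.1 hw
        refine hclosed u (hAB hu) w ((hmemU w).2 ?_) (mem_two_step.2 (.inl huw))
        have hnn : (0 : ℤ) ≤ (s - (j + 1 : ℕ)) * M :=
          mul_nonneg (sub_nonneg.2 (by exact_mod_cast hj)) (by positivity)
        exact (hfar w hw).imp (fun h => by linarith) fun h => by linarith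
      refine ⟨nbhd G A, hNB, ?_, hfar⟩
      have hNU := hsmall _ (hNB.trans hBU)
      have hhalf : 2 * #(nbhd G A) ≤ Fintype.card V := by
        have : (2 * #(nbhd G A) : ℝ) ≤ Fintype.card V := by
          refine le_of_mul_le_mul_left ?_ hd'
          nlinarith
        exact_mod_cast this
      have hexp := hG.sq_mul_card_le hhalf
      have h4 : (4 * #A : ℝ) ≤ #(nbhd G A) := by
        have hl2 : 16 * lam ^ 2 ≤ (d : ℝ) ^ 2 := by nlinarith
        have hA0 : (0 : ℝ) ≤ #A := Nat.cast_nonneg _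
        have := mul_le_mul_of_nonneg_right hl2 hA0
        have hl0 : 0 < 4 * lam ^ 2 := by positivity
        refine le_of_mul_le_mul_left ?_ hl0
        linarith
      have h4' : 4 * #A ≤ #(nbhd G A) := by exact_mod_cast h4
      rw [pow_succ]
      omega
  let P : Finset (V × ℤ) := B.image fun u => (u, f u)
  have hPB : P.image Prod.fst = B := by
    simp [P, image_image, Function.comp_def]
  have hPcard : #P = #B := card_image_of_injective _ fun u w h => (Prod.ext_iff.1 h).1
  have hmemP : ∀ u a, (u, a) ∈ P ↔ u ∈ B ∧ f u = a := by
    intro u a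
    simp only [P, mem_image, Prod.mk.injEq]
    constructor
    · rintro ⟨w, hw, rfl, rfl⟩; exact ⟨hw, rfl⟩
    · rintro ⟨hu, rfl⟩; exact ⟨u, hu, rfl, rfl⟩
  refine ⟨P, ⟨?_, ?_⟩, ?_, ?_, ?_, ?_⟩
  · rintro ⟨u, a⟩ hp
    obtain ⟨hu, rfl⟩ := (hmemP _ _).1 hp
    exact ⟨rfl, (hmemU u).1 (hBU hu)⟩
  · rw [hPB]
    intro w hw
    obtain ⟨hwN, hwB⟩ := mem_sdiff.1 hw
    obtain ⟨u, hu, huw⟩ := mem_nbhd.1 hwN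
    refine ⟨hnotU w fun hwU => hwB (hclosed u hu w hwU (mem_two_step.2 (.inl huw))),
      fun z hwz => ?_⟩
    by_cases hz : z ∈ U
    · exact .inl (hclosed u hu z hz (mem_two_step.2 (.inr ⟨w, huw, hwz⟩)))
    · exact .inr (hnotU z hz)
  · refine mem_walkSupports_of_connected mem_jumpNbhd_symm ((hmemP _ _).2 ⟨hxB, rfl⟩) ?_
    intro Q hQP hxQ hne
    have hQ : ∀ u, u ∈ Q.image Prod.fst ↔ (u, f u) ∈ Q := by
      intro u
      constructor
      · intro hu
        obtain ⟨⟨w, a⟩, hp, rfl⟩ := mem_image.1 hu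
        obtain ⟨-, rfl⟩ := (hmemP _ _).1 (hQP hp)
        exact hp
      · exact fun hu => mem_image.2 ⟨_, hu, rfl⟩
    obtain ⟨q, hq, w, hwB, hwQ, hqw⟩ := hconn (Q.image Prod.fst)
      (by rw [← hPB]; exact image_subset_image hQP) ((hQ x).2 hxQ) (by
        intro heq
        refine hne (hQP.antisymm ?_)
        rintro ⟨u, a⟩ hp
        obtain ⟨hu, rfl⟩ := (hmemP _ _).1 hp
        exact (hQ u).1 (heq ▸ hu))
    refine ⟨(q, f q), (hQ q).1 hq, (w, f w),
      mem_sdiff.2 ⟨(hmemP _ _).2 ⟨hwB, rfl⟩, fun h => hwQ ((hQ w).2 h)⟩, ?_⟩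
    refine mem_product.2 ⟨hqw, mem_Icc.2 ?_⟩
    have : |f q - f w| ≤ 2 * M := by
      rcases mem_two_step.1 hqw with h | ⟨z, hz, hz'⟩
      · have := hf q w h
        linarith [abs_nonneg (f q - f w)]
      · have := hf q z hz
        have := hf z w hz'
        linarith [abs_sub_le (f q) (f z) (f w)]
    have := abs_le.1 this
    constructor <;> dsimp only <;> linarith
  · obtain ⟨A, hAB, hcard, -⟩ := hgrow s le_rfl
    rw [hPcard]
    exact hcard.trans (card_le_card hAB)
  · rw [hPcard]
    exact card_le_univ B
  · rw [hPB, hPcard]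
    have h1 := hG.mul_card_le hlam0 (by linarith) (hsmall B hBU)
    have h2 : (#(nbhd G B) : ℝ) ≤ #(nbhd G B \ B) + #B := by
      have := card_le_card_sdiff_add_card (s := nbhd G B) (t := B)
      exact_mod_cast this
    have hB0 : (0 : ℝ) ≤ #B := Nat.cast_nonneg _
    have h3 : 8 * ((M + 1) * Λ) * #B ≤ #(nbhd G B) := by
      have hl : 0 < 4 * lam := by positivity
      refine le_of_mul_le_mul_left ?_ hl
      have := mul_le_mul_of_nonneg_right hlam hB0
      linarith
    nlinarith

lemma card_le_exp_of_isOutlier {v₀ : V} {k : ℤ} {P : Finset (V × ℤ)} {Λ : ℝ}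
    {L E : Finset (V → ℤ)} (hL : ∀ f, f ∈ L ↔ f ∈ LipSet G v₀ M) (hEL : E ⊆ L)
    (hE : ∀ f ∈ E, IsOutlier G M k f P)
    (hP : 7 * (M + 1) * Λ * #P ≤ #(nbhd G (P.image Prod.fst) \ P.image Prod.fst)) :
    (#E : ℝ) ≤ #L * (M + 2) * Real.exp (-(7 * Λ * #P)) := by
  have h := card_mul_pow_le_of_isOutlier hL hEL hE
  set m := #(nbhd G (P.image Prod.fst) \ P.image Prod.fst)
  have hM1 : (0 : ℝ) < M + 1 := by positivity
  have hratio : (M : ℝ) ^ m ≤ Real.exp (-(7 * Λ * #P)) * (M + 1) ^ m := by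
    have h1 : (M : ℝ) ≤ Real.exp (-(1 / (M + 1))) * (M + 1) := by
      have := Real.add_one_le_exp (-(1 / ((M : ℝ) + 1)))
      calc (M : ℝ) = (-(1 / ((M : ℝ) + 1)) + 1) * (M + 1) := by field_simp; ring
        _ ≤ _ := by gcongr
    calc (M : ℝ) ^ m ≤ (Real.exp (-(1 / (M + 1))) * (M + 1)) ^ m := by gcongr
      _ = Real.exp (m * -(1 / (M + 1))) * (M + 1) ^ m := by rw [mul_pow, ← Real.exp_nat_mul]
      _ ≤ _ := by
        gcongr
        have : 7 * Λ * #P ≤ m / (M + 1) := by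
          rw [le_div_iff₀ hM1]; linarith
        linarith [this, mul_one_div (m : ℝ) ((M : ℝ) + 1)]
  have h' : (#E : ℝ) * (M + 1) ^ m ≤ #L * ((M + 2) * M ^ m) := by exact_mod_cast h
  refine le_of_mul_le_mul_right ?_ (pow_pos hM1 m)
  calc (#E : ℝ) * (M + 1) ^ m ≤ #L * ((M + 2) * M ^ m) := h'
    _ ≤ #L * ((M + 2) * (Real.exp (-(7 * Λ * #P)) * (M + 1) ^ m)) := by gcongr
    _ = _ := by ring

lemma IsExpander.card_large_le (hG : IsExpander G d lam) (hd : 0 < d) (hM : 0 < M)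
    (hconn : G.Connected) (hlam : 32 * (M + 1) * Real.log (9 * M * d ^ 2) * lam ≤ d) {v₀ : V}
    {s : ℕ} (hs : 1 + Real.log (Fintype.card V) ≤ 4 ^ s)
    {L E : Finset (V → ℤ)} (hL : ∀ f, f ∈ L ↔ f ∈ LipSet G v₀ M) (hEL : E ⊆ L)
    (hE : ∀ f ∈ E, ∃ v, (2 * s + 1) * (M : ℤ) < f v) :
    (#E : ℝ) ≤ #L / (Fintype.card V : ℝ) ^ 2 := by
  classical
  set n := Fintype.card V with hn_def
  have hn : 0 < n := Fintype.card_pos_iff.2 ⟨v₀⟩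
  have hn1 : (1 : ℝ) ≤ n := by exact_mod_cast hn
  have hd1 : (1 : ℝ) ≤ d := by exact_mod_cast hd
  have hM1 : (1 : ℝ) ≤ M := by exact_mod_cast hM
  have hlam0 := hG.pos hd v₀
  set Λ := Real.log (9 * M * d ^ 2) with hΛ_def
  have hd2 : (1 : ℝ) ≤ d ^ 2 := one_le_pow₀ hd1
  have hMd : (M : ℝ) ≤ M * d ^ 2 := le_mul_of_one_le_right (by positivity) hd2
  have hexpΛ : Real.exp Λ = 9 * M * d ^ 2 := Real.exp_log (by positivity)
  have hΛ : 2 ≤ Λ := by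
    rw [hΛ_def, Real.le_log_iff_exp_le (by positivity)]
    have h1 : Real.exp 2 = Real.exp 1 ^ 2 := by rw [← Real.exp_nat_mul]; norm_num
    have h2 := Real.exp_one_lt_three
    have h3 := Real.exp_pos 1
    rw [h1]
    nlinarith
  have hlamd : lam < d := by
    have : 1 ≤ (M + 1) * Λ := by nlinarith
    nlinarith
  let I : Finset ℤ := Icc (-(M * n : ℤ)) (M * n)
  let J : Finset ((ℤ × V × ℤ) × ℕ) := (I ×ˢ (univ ×ˢ I)) ×ˢ Icc (4 ^ s) n
  let shapes : (ℤ × V × ℤ) × ℕ → Finset (Finset (V × ℤ)) := fun j =>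
    {P ∈ walkSupports (jumpNbhd G M) (2 * (j.2 - 1)) j.1.2 | #P = j.2 ∧
      7 * (M + 1) * Λ * #P ≤ #(nbhd G (P.image Prod.fst) \ P.image Prod.fst)}
  have hcover : E ⊆ J.biUnion fun j => (shapes j).biUnion fun P =>
      E.filter fun f => IsOutlier G M j.1.1 f P := by
    intro f hf
    have hfL := (hL f).1 (hEL hf)
    have hfI : ∀ v, f v ∈ I := fun v => mem_Icc.2 (abs_le.1 (abs_le_of_mem_lipSet hconn hfL v))
    obtain ⟨u, hlow, hhigh⟩ := hG.exists_ground_value hd hlamd v₀ hfL.2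
    obtain ⟨x, hx⟩ : ∃ x, f x < f u - s * M ∨ f u + M + s * M < f x := by
      obtain ⟨v, hv⟩ := hE f hf
      by_contra! hcon
      have h1 := (hcon v₀).1
      have h2 := (hcon v).2
      rw [hfL.1] at h1
      linarith
    obtain ⟨P, hP, hPw, hPs, hPn, hPb⟩ :=
      hG.exists_isOutlier hd (by linarith) hlam hfL.2 hlow hhigh hx
    refine mem_biUnion.2 ⟨((f u, x, f x), #P), ?_, mem_biUnion.2 ⟨P, ?_, ?_⟩⟩
    · simp only [J, mem_product, mem_univ, true_and]
      exact ⟨⟨hfI u, hfI x⟩, mem_Icc.2 ⟨hPs, hPn⟩⟩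
    · exact mem_filter.2 ⟨hPw, rfl, hPb⟩
    · exact mem_filter.2 ⟨hf, hP⟩
  have hterm : ∀ j ∈ J, (#((shapes j).biUnion fun P =>
      E.filter fun f => IsOutlier G M j.1.1 f P) : ℝ) ≤
        #L * (M + 2) * Real.exp (-(3 * Λ * 4 ^ s)) := by
    rintro ⟨⟨k, p⟩, b⟩ hj
    have hb : (4 : ℝ) ^ s ≤ b := by
      have := (mem_Icc.1 (mem_product.1 hj).2).1
      exact_mod_cast this
    have hshapes : (#(shapes ((k, p), b)) : ℝ) ≤ Real.exp (4 * Λ * b) := by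
      have h1 : #(shapes ((k, p), b)) ≤ (10 * M * d ^ 2) ^ (2 * (b - 1)) :=
        (card_filter_le _ _).trans
          (card_walkSupports_le (card_jumpNbhd_le hG.1 hd hM) _ _)
      have h2 : (10 * M * d ^ 2 : ℝ) ≤ Real.exp (2 * Λ) := by
        rw [two_mul, Real.exp_add, hexpΛ]
        nlinarith
      calc (#(shapes ((k, p), b)) : ℝ) ≤ (10 * M * d ^ 2) ^ (2 * (b - 1)) := by exact_mod_cast h1
        _ ≤ Real.exp (2 * Λ) ^ (2 * (b - 1)) := by gcongr
        _ ≤ Real.exp (2 * Λ) ^ (2 * b) :=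
          pow_le_pow_right₀ (Real.one_le_exp (by linarith)) (by omega)
        _ = Real.exp (4 * Λ * b) := by
          rw [← Real.exp_nat_mul]; push_cast; ring_nf
    calc (#((shapes ((k, p), b)).biUnion fun P =>
          E.filter fun f => IsOutlier G M k f P) : ℝ)
        ≤ ∑ P ∈ shapes ((k, p), b), (#(E.filter fun f => IsOutlier G M k f P) : ℝ) := by
          exact_mod_cast card_biUnion_le
      _ ≤ ∑ P ∈ shapes ((k, p), b), #L * (M + 2) * Real.exp (-(7 * Λ * b)) := by
          refine sum_le_sum fun P hP => ?_
          obtain ⟨-, hPb, hPbd⟩ := mem_filter.1 hP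
          have hPb : #P = b := hPb
          rw [← hPb]
          exact card_le_exp_of_isOutlier hL ((filter_subset _ _).trans hEL)
            (fun f hf => (mem_filter.1 hf).2) hPbd
      _ = #(shapes ((k, p), b)) * (#L * (M + 2) * Real.exp (-(7 * Λ * b))) := by
          rw [sum_const, nsmul_eq_mul]
      _ ≤ Real.exp (4 * Λ * b) * (#L * (M + 2) * Real.exp (-(7 * Λ * b))) := by gcongr
      _ = #L * (M + 2) * Real.exp (-(3 * Λ * b)) := by
          rw [show -(3 * Λ * b) = 4 * Λ * b + -(7 * Λ * b) by ring, Real.exp_add]; ring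
      _ ≤ _ := by gcongr
  have hJ : (#J : ℝ) ≤ 9 * M ^ 2 * n ^ 4 := by
    have hI : #I ≤ 3 * M * n := by
      have hMn : 1 ≤ M * n := Nat.mul_pos hM hn
      have : #I = 2 * (M * n) + 1 := by
        simp only [I]
        rw [Int.card_Icc]
        have : (M * n : ℤ) = ((M * n : ℕ) : ℤ) := by push_cast; rfl
        rw [this]
        omega
      rw [this, mul_assoc]
      omega
    have hlen : #(Icc (4 ^ s) n) ≤ n := by
      have : 0 < 4 ^ s := by positivity
      rw [Nat.card_Icc]; omega
    have : #J ≤ 9 * M ^ 2 * n ^ 4 := by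
      simp only [J, card_product, card_univ, ← hn_def]
      calc _ ≤ 3 * M * n * (n * (3 * M * n)) * n := by gcongr
        _ = _ := by ring
    exact_mod_cast this
  have hdecay : 27 * (M : ℝ) ^ 3 * n ^ 6 * Real.exp (-(3 * Λ * 4 ^ s)) ≤ 1 := by
    have h1 : 27 * (M : ℝ) ^ 3 ≤ Real.exp (3 * Λ) := by
      have : Real.exp (3 * Λ) = Real.exp Λ ^ 3 := by rw [← Real.exp_nat_mul]; norm_num
      rw [this, hexpΛ]
      calc 27 * (M : ℝ) ^ 3 = (3 * M) ^ 3 := by ring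
        _ ≤ _ := pow_le_pow_left₀ (by positivity) (by nlinarith) 3
    have h2 : (n : ℝ) ^ 6 = Real.exp (6 * Real.log n) := by
      have : (6 : ℝ) = (6 : ℕ) := by norm_num
      rw [this, Real.exp_nat_mul, Real.exp_log (by positivity)]
    have hlog : 0 ≤ Real.log n := Real.log_nonneg hn1
    calc _ ≤ Real.exp (3 * Λ) * Real.exp (6 * Real.log n) * Real.exp (-(3 * Λ * 4 ^ s)) := by
          rw [h2]; gcongr
      _ = Real.exp (3 * Λ + 6 * Real.log n + -(3 * Λ * 4 ^ s)) := by
          rw [Real.exp_add, Real.exp_add]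
      _ ≤ 1 := by
          rw [Real.exp_le_one_iff]
          nlinarith
  rw [le_div_iff₀ (by positivity)]
  calc (#E : ℝ) * n ^ 2
      ≤ (∑ j ∈ J, (#((shapes j).biUnion fun P =>
          E.filter fun f => IsOutlier G M j.1.1 f P) : ℝ)) * n ^ 2 := by
        gcongr
        exact_mod_cast (card_le_card hcover).trans card_biUnion_le
    _ ≤ (#J * (#L * (M + 2) * Real.exp (-(3 * Λ * 4 ^ s)))) * n ^ 2 := by
        gcongr
        rw [← nsmul_eq_mul]
        exact sum_le_card_nsmul _ _ _ hterm
    _ ≤ (9 * M ^ 2 * n ^ 4 * (#L * (3 * M) * Real.exp (-(3 * Λ * 4 ^ s)))) * n ^ 2 := by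
        gcongr
        linarith
    _ = #L * (27 * (M : ℝ) ^ 3 * n ^ 6 * Real.exp (-(3 * Λ * 4 ^ s))) := by ring
    _ ≤ #L := mul_le_of_le_one_right (by positivity) hdecay

end Lipschitz

lemma exists_nat_one_add_log_le_four_pow {n : ℝ} (hn : 3 ≤ n) :
    ∃ s : ℕ, 1 + Real.log n ≤ 4 ^ s ∧
      2 * (s : ℝ) + 1 ≤ (2 + 5 / Real.log (Real.log 3)) * Real.log (Real.log n) := by
  have hlog3 : 1 < Real.log 3 := by
    rw [Real.lt_log_iff_exp_lt (by norm_num)]; exact Real.exp_one_lt_three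
  have hloglog3 : 0 < Real.log (Real.log 3) := Real.log_pos hlog3
  have hlog : Real.log 3 ≤ Real.log n := Real.log_le_log (by norm_num) hn
  have hloglog : Real.log (Real.log 3) ≤ Real.log (Real.log n) :=
    Real.log_le_log (by linarith) hlog
  have hl0 : 0 < Real.log n := by linarith
  refine ⟨⌈Real.log (Real.log n) + 1⌉₊, ?_, ?_⟩
  · have h1 := Nat.le_ceil (Real.log (Real.log n) + 1)
    set s := ⌈Real.log (Real.log n) + 1⌉₊
    have h2 : Real.log n * 2 ≤ Real.exp s := by
      calc Real.log n * 2 ≤ Real.log n * Real.exp 1 := by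
            gcongr
            linarith [Real.add_one_le_exp (1 : ℝ)]
        _ = Real.exp (Real.log (Real.log n) + 1) := by rw [Real.exp_add, Real.exp_log hl0]
        _ ≤ _ := by gcongr
    have h3 : Real.exp s ≤ 4 ^ s := by
      rw [← mul_one (s : ℝ), Real.exp_nat_mul]
      gcongr
      linarith [Real.exp_one_lt_three]
    linarith
  · have h1 := Nat.ceil_lt_add_one (a := Real.log (Real.log n) + 1) (by linarith)
    have h2 : 5 ≤ 5 / Real.log (Real.log 3) * Real.log (Real.log n) := by
      rw [div_mul_eq_mul_div, le_div_iff₀ hloglog3]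
      linarith
    linarith

theorem stmt2 (d M : ℕ) (lam : ℝ) (hM : 0 < M)
    (hlam : lam ≤ (d : ℝ) / (32 * ((M : ℝ) + 1) * Real.log (9 * M * d ^ 2))) :
    ∃ C : ℝ, 0 < C ∧
      ∀ (V : Type) [Fintype V], ∀ (G : SimpleGraph V) [DecidableRel G.Adj],
        3 ≤ Fintype.card V → G.Connected → IsExpander G d lam →
        ∀ v₀ : V,
          ({f ∈ LipSet G v₀ M |
              ∃ v : V, C * M * Real.log (Real.log (Fintype.card V)) < (f v : ℝ)}.ncard : ℝ) ≤
            ((LipSet G v₀ M).ncard : ℝ) / (Fintype.card V : ℝ) ^ 2 := by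
  classical
  have hlog3 : 1 < Real.log 3 := by
    rw [Real.lt_log_iff_exp_lt (by norm_num)]; exact Real.exp_one_lt_three
  have hloglog3 : 0 < Real.log (Real.log 3) := Real.log_pos hlog3
  refine ⟨2 + 5 / Real.log (Real.log 3), by positivity, ?_⟩
  intro V _ G _ hcard hconn hG v₀
  have hd : 0 < d := by
    have : Nontrivial V := Fintype.one_lt_card_iff_nontrivial.1 (by omega)
    rw [← hG.1 v₀]
    exact hconn.preconnected.degree_pos_of_nontrivial v₀
  have hM1 : (1 : ℝ) ≤ M := by exact_mod_cast hM
  have hd1 : (1 : ℝ) ≤ d := by exact_mod_cast hd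
  have hlogpos : 0 < Real.log (9 * M * d ^ 2) :=
    Real.log_pos (by nlinarith [one_le_pow₀ hd1 (n := 2)])
  have hlam' : 32 * (M + 1) * Real.log (9 * M * d ^ 2) * lam ≤ d := by
    rw [le_div_iff₀ (by positivity)] at hlam
    linarith
  obtain ⟨s, hs, hsC⟩ :=
    exists_nat_one_add_log_le_four_pow (n := Fintype.card V) (by exact_mod_cast hcard)
  have hfin := finite_lipSet (M := M) hconn v₀
  have hfinE := hfin.subset (Set.sep_subset (LipSet G v₀ M) fun f => ∃ v : V,
    (2 + 5 / Real.log (Real.log 3)) * M * Real.log (Real.log (Fintype.card V)) < (f v : ℝ))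
  rw [Set.ncard_eq_toFinset_card _ hfin, Set.ncard_eq_toFinset_card _ hfinE]
  refine hG.card_large_le hd hM hconn hlam' hs (fun f => hfin.mem_toFinset)
    (Set.Finite.toFinset_subset_toFinset.2 (Set.sep_subset _ _)) fun f hf => ?_
  obtain ⟨v, hv⟩ := (hfinE.mem_toFinset.1 hf).2
  refine ⟨v, ?_⟩
  have : (2 * (s : ℝ) + 1) * M < f v := by nlinarith
  exact_mod_cast this
end

section
/- Let G be a finite connected 2n-vertex d-regular λ-bi-expander with color classes V₀ and V₁, with λ ≤ d/(300·log d), and let v₀ be a vertex of G. Then there exists a function Φ : Hom_{v₀}(G) → ℤ such that: (i) for every f ∈ Hom_{v₀}(G) there exists i ∈ {0,1} such that the number of vertices v ∈ V_i with f(v) ≠ Φ(f) is at most 2λn/d, and the number of vertices v ∈ V(G) with |f(v) − Φ(f)| ≥ 2 is at most 3λn/d; and (ii) for every vertex v of G and every positive integer t, the number of f ∈ Hom_{v₀}(G) with |f(v) − Φ(f)| > t is at most exp(−|B(v,t)|/3) times the total number of functions in Hom_{v₀}(G). -/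
/-- `G` is a `d`-regular `λ`-bi-expander with `2n` vertices and color classes `V0`, `V1`. -/
def IsBiExpander {V : Type*} [Fintype V] (G : SimpleGraph V) [DecidableRel G.Adj]
    (V0 V1 : Finset V) (n d : ℕ) (lam : ℝ) : Prop :=
  Fintype.card V = 2 * n ∧ V0.card = n ∧ V1.card = n ∧
  (∀ v : V, v ∈ V0 ∨ v ∈ V1) ∧ Disjoint V0 V1 ∧
  (∀ u v : V, G.Adj u v → (u ∈ V0 ∧ v ∈ V1) ∨ (u ∈ V1 ∧ v ∈ V0)) ∧
  (∀ v : V, G.degree v = d) ∧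
  ∀ S T : Finset V, S ⊆ V0 → T ⊆ V1 →
    |(edgeCount G S T : ℝ) - (d : ℝ) / (n : ℝ) * S.card * T.card| ≤
      lam * Real.sqrt ((S.card : ℝ) * T.card)

/-- Graph homomorphisms from `G` to `ℤ` vanishing at `v₀`. -/
def HomSet {V : Type*} (G : SimpleGraph V) (v₀ : V) : Set (V → ℤ) :=
  {f | f v₀ = 0 ∧ ∀ u v : V, G.Adj u v → |f u - f v| = 1}

/-- The ball of radius `t` around `v` in the graph metric of `G`. -/
def gBall {V : Type*} (G : SimpleGraph V) (v : V) (t : ℕ) : Set V :=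
  {w | G.Reachable v w ∧ G.dist v w ≤ t}

open Finset

/-- Integer-valued functions changing by exactly one along every edge. -/
def IsHeight {V : Type*} (G : SimpleGraph V) (f : V → ℤ) : Prop :=
  ∀ u v : V, G.Adj u v → |f u - f v| = 1

theorem IsHeight.sub_const {V : Type*} {G : SimpleGraph V} {f : V → ℤ} (hf : IsHeight G f)
    (c : ℤ) : IsHeight G (fun v => f v - c) := by
  intro u v huv
  simpa using hf u v huv

theorem IsHeight.const_sub {V : Type*} {G : SimpleGraph V} {f : V → ℤ} (hf : IsHeight G f)
    (c : ℤ) : IsHeight G (fun v => c - f v) := by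
  intro u v huv
  have := hf v u huv.symm
  simpa using this

theorem IsHeight.cases {V : Type*} {G : SimpleGraph V} {f : V → ℤ} (hf : IsHeight G f)
    {u v : V} (huv : G.Adj u v) : f u = f v + 1 ∨ f u = f v - 1 := by
  have := hf u v huv
  rcases abs_eq (by norm_num : (0 : ℤ) ≤ 1) |>.1 this with h | h <;> omega

theorem edgeCount_comm {V : Type*} (G : SimpleGraph V) [DecidableRel G.Adj] (S T : Finset V) :
    edgeCount G S T = edgeCount G T S := by
  unfold edgeCount
  refine Finset.card_bij (fun p _ => (p.2, p.1)) ?_ ?_ ?_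
  · simp only [mem_filter, mem_product]
    rintro ⟨a, b⟩ ⟨⟨ha, hb⟩, hab⟩
    exact ⟨⟨hb, ha⟩, hab.symm⟩
  · rintro ⟨a, b⟩ _ ⟨c, e⟩ _ h
    simp only [Prod.mk.injEq] at h ⊢
    exact ⟨h.2, h.1⟩
  · rintro ⟨a, b⟩ h
    simp only [mem_filter, mem_product] at h
    exact ⟨(b, a), by simpa using ⟨⟨h.1.2, h.1.1⟩, h.2.symm⟩, rfl⟩

theorem edgeCount_eq_sum {V : Type*} (G : SimpleGraph V) [DecidableRel G.Adj] (S T : Finset V) :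
    edgeCount G S T = ∑ a ∈ S, (T.filter (G.Adj a)).card := by
  unfold edgeCount
  rw [Finset.card_filter, Finset.sum_product]
  simp only [Finset.card_filter]

section Expander

variable {V : Type*} [Fintype V] {G : SimpleGraph V} [DecidableRel G.Adj]
  {V0 V1 : Finset V} {n d : ℕ} {lam : ℝ}

theorem IsBiExpander.symm (hG : IsBiExpander G V0 V1 n d lam) :
    IsBiExpander G V1 V0 n d lam := by
  obtain ⟨h1, h2, h3, h4, h5, h6, h7, h8⟩ := hG
  refine ⟨h1, h3, h2, fun v => (h4 v).symm, h5.symm, fun u v h => (h6 u v h).symm, h7, ?_⟩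
  intro S T hS hT
  have := h8 T S hT hS
  rw [edgeCount_comm, mul_comm (S.card : ℝ)]
  convert this using 3
  ring

theorem IsBiExpander.mem_right (hG : IsBiExpander G V0 V1 n d lam) {u v : V} (hu : u ∈ V0)
    (h : G.Adj u v) : v ∈ V1 := by
  obtain ⟨-, -, -, -, h5, h6, -, -⟩ := hG
  rcases h6 u v h with h' | h'
  · exact h'.2
  · exact absurd h'.1 (Finset.disjoint_left.1 h5 hu)

theorem IsBiExpander.mem_left (hG : IsBiExpander G V0 V1 n d lam) {u v : V} (hu : u ∈ V1)
    (h : G.Adj u v) : v ∈ V0 := hG.symm.mem_right hu h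

theorem IsBiExpander.notMem_right (hG : IsBiExpander G V0 V1 n d lam) {u : V} (hu : u ∈ V0) :
    u ∉ V1 := Finset.disjoint_left.1 hG.2.2.2.2.1 hu

theorem IsBiExpander.notMem_left (hG : IsBiExpander G V0 V1 n d lam) {u : V} (hu : u ∈ V1) :
    u ∉ V0 := hG.symm.notMem_right hu

theorem IsBiExpander.n_pos (hG : IsBiExpander G V0 V1 n d lam) (hconn : G.Connected) :
    0 < n := by
  have := hconn.nonempty
  have h := Fintype.card_pos (α := V)
  have := hG.1
  omega

theorem IsBiExpander.d_pos (hG : IsBiExpander G V0 V1 n d lam) (hconn : G.Connected) :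
    0 < d := by
  have hn := hG.n_pos hconn
  have : Nontrivial V := by
    rw [← Fintype.one_lt_card_iff_nontrivial, hG.1]; omega
  obtain ⟨v⟩ := hconn.nonempty
  have h := hconn.preconnected.degree_pos_of_nontrivial v
  rwa [hG.2.2.2.2.2.2.1 v] at h

theorem IsBiExpander.lam_nonneg (hG : IsBiExpander G V0 V1 n d lam) (hconn : G.Connected) :
    0 ≤ lam := by
  have hn := hG.n_pos hconn
  obtain ⟨-, h2, h3, -, -, -, -, h8⟩ := hG
  obtain ⟨a, ha⟩ := Finset.card_pos.1 (h2 ▸ hn)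
  obtain ⟨b, hb⟩ := Finset.card_pos.1 (h3 ▸ hn)
  have := h8 {a} {b} (by simpa using ha) (by simpa using hb)
  have h0 := (abs_nonneg _).trans this
  simpa using h0

/-- The number of edges out of `T` when all neighbours of `T` lie in `S`. -/
theorem IsBiExpander.edgeCount_of_neighbors (hG : IsBiExpander G V0 V1 n d lam)
    {S T : Finset V} (h : ∀ a ∈ S, ∀ b, G.Adj a b → b ∈ T) :
    edgeCount G S T = d * S.card := by
  rw [edgeCount_eq_sum, Finset.sum_congr rfl (g := fun _ => d), Finset.sum_const, smul_eq_mul,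
    mul_comm]
  intro a ha
  rw [← hG.2.2.2.2.2.2.1 a, ← SimpleGraph.card_neighborFinset_eq_degree]
  congr 1
  ext b
  simp only [mem_filter, SimpleGraph.mem_neighborFinset]
  exact ⟨fun h => h.2, fun hb => ⟨h a ha b hb, hb⟩⟩

theorem IsBiExpander.card_mul_card_le (hG : IsBiExpander G V0 V1 n d lam)
    (hconn : G.Connected) {S T : Finset V} (hS : S ⊆ V0) (hT : T ⊆ V1)
    (h : ∀ a ∈ S, ∀ b ∈ T, ¬ G.Adj a b) :
    (S.card : ℝ) * T.card ≤ (lam * n / d) ^ 2 := by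
  have hn : (0 : ℝ) < n := by exact_mod_cast hG.n_pos hconn
  have hd : (0 : ℝ) < d := by exact_mod_cast hG.d_pos hconn
  have h0 : edgeCount G S T = 0 := by
    unfold edgeCount
    rw [Finset.card_eq_zero, Finset.filter_eq_empty_iff]
    rintro ⟨a, b⟩ hab
    rw [mem_product] at hab
    exact h a hab.1 b hab.2
  have h8 := hG.2.2.2.2.2.2.2 S T hS hT
  rw [h0, Nat.cast_zero, zero_sub, abs_neg, mul_assoc] at h8
  set x : ℝ := (S.card : ℝ) * T.card with hx
  have hx0 : 0 ≤ x := by positivity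
  have h9 : (d : ℝ) / n * x ≤ lam * √x := (le_abs_self _).trans h8
  have hs := Real.sq_sqrt hx0
  have hs0 := Real.sqrt_nonneg x
  rcases hs0.eq_or_lt with h' | h'
  · have : x = 0 := by rw [← hs, ← h']; norm_num
    rw [this]; positivity
  · have h10 : (d : ℝ) / n * √x ≤ lam := by
      rw [← hs] at h9
      have : (d : ℝ) / n * √x * √x ≤ lam * √x := by
        rw [Real.sqrt_sq hs0] at h9
        nlinarith
      exact le_of_mul_le_mul_right this h'
    have h11 : √x ≤ lam * n / d := by
      rw [le_div_iff₀ hd]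
      rw [div_mul_eq_mul_div, div_le_iff₀ hn] at h10
      linarith
    rw [← hs]
    gcongr

/-- Expansion of small sets: a set containing all neighbours of `S` is large. -/
theorem IsBiExpander.card_le_of_neighbors (hG : IsBiExpander G V0 V1 n d lam)
    (hconn : G.Connected) {S N : Finset V} (hS : S ⊆ V0) (hN : N ⊆ V1)
    (h : ∀ a ∈ S, ∀ b, G.Adj a b → b ∈ N) :
    (S.card : ℝ) ≤ S.card * N.card / n + lam / d * √(S.card * N.card) := by
  have hd : (0 : ℝ) < d := by exact_mod_cast hG.d_pos hconn
  have h8 := (le_abs_self _).trans (hG.2.2.2.2.2.2.2 S N hS hN)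
  rw [hG.edgeCount_of_neighbors h] at h8
  push_cast at h8
  have : (d : ℝ) * S.card ≤ d * (S.card * N.card / n + lam / d * √(S.card * N.card)) := by
    have e : (d : ℝ) * (S.card * N.card / n + lam / d * √(S.card * N.card)) =
      d / n * S.card * N.card + lam * √(S.card * N.card) := by
      field_simp
    rw [e]; linarith
  exact le_of_mul_le_mul_left this hd

theorem IsBiExpander.card_le_four_mul (hG : IsBiExpander G V0 V1 n d lam)
    (hconn : G.Connected) (hlam : lam ≤ d / 200) {S N : Finset V} (hS : S ⊆ V0) (hN : N ⊆ V1)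
    (h : ∀ a ∈ S, ∀ b, G.Adj a b → b ∈ N) (hcard : (S.card : ℝ) ≤ 2 * (lam * n / d)) :
    (S.card : ℝ) ≤ 4 * (lam / d) * N.card := by
  have hn : (0 : ℝ) < n := by exact_mod_cast hG.n_pos hconn
  have hd : (0 : ℝ) < d := by exact_mod_cast hG.d_pos hconn
  have hl := hG.lam_nonneg hconn
  have key := hG.card_le_of_neighbors hconn hS hN h
  set s : ℝ := (S.card : ℝ)
  set N' : ℝ := (N.card : ℝ)
  have hs : 0 ≤ s := Nat.cast_nonneg _
  have hN' : 0 ≤ N' := Nat.cast_nonneg _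
  have he : 0 ≤ lam / d := by positivity
  have he1 : lam / d ≤ 1 / 200 := by rw [div_le_iff₀ hd]; linarith
  have hcard' : s ≤ 2 * (lam / d) * n := by
    calc s ≤ _ := hcard
      _ = _ := by ring
  set e := lam / (d : ℝ)
  by_cases hc : N' ≤ n / 2
  · have h1 : s * N' / n ≤ s / 2 := by
      rw [div_le_iff₀ hn]; nlinarith
    have h2 : s / 2 ≤ e * √(s * N') := by linarith
    have h3 : (s / 2) ^ 2 ≤ e ^ 2 * (s * N') := by
      calc (s / 2) ^ 2 ≤ (e * √(s * N')) ^ 2 := by gcongr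
        _ = _ := by rw [mul_pow, Real.sq_sqrt (by positivity)]
    rcases hs.eq_or_lt with h0 | h0
    · rw [← h0]; positivity
    · have h4 : s ≤ 4 * e ^ 2 * N' := by
        have : s * s ≤ s * (4 * e ^ 2 * N') := by nlinarith
        exact le_of_mul_le_mul_left this h0
      have h5 : e ^ 2 ≤ e := by nlinarith
      nlinarith
  · push Not at hc
    nlinarith

theorem IsBiExpander.card_interior_le (hG : IsBiExpander G V0 V1 n d lam)
    (hconn : G.Connected) (hlam : lam ≤ d / 200) {S T : Finset V} (hS : S ⊆ V0) (hT : T ⊆ V1)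
    (h : ∀ b ∈ T, ∀ a, G.Adj b a → a ∈ S) (hcard : (S.card : ℝ) ≤ 2 * (lam * n / d)) :
    (T.card : ℝ) ≤ S.card := by
  have hn : (0 : ℝ) < n := by exact_mod_cast hG.n_pos hconn
  have hd : (0 : ℝ) < d := by exact_mod_cast hG.d_pos hconn
  have hl := hG.lam_nonneg hconn
  have key := hG.symm.card_le_of_neighbors hconn hT hS h
  set s : ℝ := (S.card : ℝ)
  set N' : ℝ := (T.card : ℝ)
  have hs : 0 ≤ s := Nat.cast_nonneg _
  have hN' : 0 ≤ N' := Nat.cast_nonneg _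
  have he : 0 ≤ lam / d := by positivity
  have he1 : lam / d ≤ 1 / 200 := by rw [div_le_iff₀ hd]; linarith
  have hcard' : s ≤ 2 * (lam / d) * n := by
    calc s ≤ _ := hcard
      _ = _ := by ring
  set e := lam / (d : ℝ)
  by_contra! hc
  have h1 : √(N' * s) ≤ N' := by
    rw [Real.sqrt_le_left hN']
    nlinarith
  have h2 : N' * s / n ≤ 2 * e * N' := by
    rw [div_le_iff₀ hn]; nlinarith
  nlinarith

theorem IsBiExpander.exists_adj (hG : IsBiExpander G V0 V1 n d lam) (hconn : G.Connected)
    (v : V) : ∃ w, G.Adj v w := by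
  have := hG.d_pos hconn
  rw [← hG.2.2.2.2.2.2.1 v, SimpleGraph.degree_pos_iff_exists_adj] at this
  exact this

end Expander

theorem exists_median {V : Type*} [DecidableEq V] (f : V → ℤ) {W : Finset V} (hW : W.Nonempty) :
    ∃ m, (∃ x ∈ W, f x = m) ∧ (W.card : ℝ) / 2 ≤ (W.filter (fun v => f v ≤ m)).card ∧
      (W.card : ℝ) / 2 ≤ (W.filter (fun v => m ≤ f v)).card := by
  have hpos : (0 : ℝ) < W.card := by exact_mod_cast hW.card_pos
  obtain ⟨m, hm, hmin⟩ := Int.exists_least_of_bdd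
    (P := fun m => (W.card : ℝ) / 2 ≤ (W.filter (fun v => f v ≤ m)).card)
    ⟨W.inf' hW f, by
      intro z hz
      by_contra! hlt
      have : W.filter (fun v => f v ≤ z) = ∅ := by
        rw [filter_eq_empty_iff]
        intro v hv
        have := Finset.inf'_le f hv
        omega
      rw [this] at hz
      simp at hz
      linarith⟩
    ⟨W.sup' hW f, by
      rw [filter_true_of_mem (fun v hv => Finset.le_sup' f hv)]
      linarith⟩
  have hlt : ((W.filter (fun v => f v ≤ m - 1)).card : ℝ) < W.card / 2 := by
    by_contra! h
    have := hmin _ h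
    omega
  refine ⟨m, ?_, hm, ?_⟩
  · by_contra! h
    refine absurd (hm.trans_lt' hlt) ?_
    rw [not_lt]
    norm_cast
    refine card_le_card fun v hv => ?_
    simp only [mem_filter] at hv ⊢
    have := h v hv.1
    exact ⟨hv.1, by omega⟩
  · have : (W.card : ℝ) ≤ (W.filter (fun v => f v ≤ m - 1)).card +
        (W.filter (fun v => m ≤ f v)).card := by
      norm_cast
      refine (card_le_card ?_).trans (card_union_le _ _)
      intro v hv
      simp only [mem_union, mem_filter]
      by_cases h : f v ≤ m - 1
      · left; exact ⟨hv, h⟩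
      · right; exact ⟨hv, by omega⟩
    linarith

section Flatness

variable {V : Type*} [Fintype V] {G : SimpleGraph V} [DecidableRel G.Adj]
  {V0 V1 : Finset V} {n d : ℕ} {lam : ℝ}

/-- `f` is close to the constant `c`: it equals `c` on most of the class `W` and is within distance
one of `c` on most of the graph, with error terms measured by `δ`. -/
def IsFlatAround (f : V → ℤ) (W : Finset V) (c : ℤ) (δ : ℝ) : Prop :=
  ((W.filter (fun v => f v ≠ c)).card : ℝ) ≤ 2 * δ ∧
    ((univ.filter (fun v => 2 ≤ |f v - c|)).card : ℝ) ≤ 3 * δ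

theorem IsFlatAround.of_neg {f : V → ℤ} {W : Finset V} {c : ℤ} {δ : ℝ}
    (h : IsFlatAround (fun v => -f v) W c δ) : IsFlatAround f W (-c) δ := by
  unfold IsFlatAround at h ⊢
  have e1 : ∀ v, f v ≠ -c ↔ -f v ≠ c := fun v => by rw [not_iff_not]; omega
  have e2 : ∀ v, |f v - -c| = |-f v - c| := fun v => by
    rw [← abs_neg]; congr 1; ring
  simpa only [e1, e2] using h

/-- Sets separated by a gap of `f` are joined by no edge, so they cannot both be large. -/
theorem IsBiExpander.card_mul_card_le_of_gap (hG : IsBiExpander G V0 V1 n d lam)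
    (hconn : G.Connected) {f : V → ℤ} (hf : IsHeight G f) {S T : Finset V} (hS : S ⊆ V0)
    (hT : T ⊆ V1) (h : ∀ a ∈ S, ∀ b ∈ T, f a + 2 ≤ f b ∨ f b + 2 ≤ f a) :
    (S.card : ℝ) * T.card ≤ (lam * n / d) ^ 2 := by
  refine hG.card_mul_card_le hconn hS hT fun a ha b hb hab => ?_
  rcases hf.cases hab with h1 | h1 <;> rcases h a ha b hb with h2 | h2 <;> omega

variable [DecidableEq V]

theorem parity_eq (hG : IsBiExpander G V0 V1 n d lam) (hconn : G.Connected) {f : V → ℤ}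
    (hf : IsHeight G f) (x y : V) :
    (f x + if x ∈ V0 then 0 else 1) % 2 = (f y + if y ∈ V0 then 0 else 1) % 2 := by
  obtain ⟨p⟩ := hconn.preconnected x y
  induction p with
  | nil => rfl
  | @cons u v w h p ih =>
    rw [← ih]
    rcases hG.2.2.2.2.2.1 u v h with h' | h'
    · have h1 := hG.notMem_left h'.2
      rw [if_pos h'.1, if_neg h1]
      rcases hf.cases h with h2 | h2 <;> omega
    · have h1 := hG.notMem_left h'.1
      rw [if_neg h1, if_pos h'.2]
      rcases hf.cases h with h2 | h2 <;> omega

theorem flat_of_median_of_few_below (hG : IsBiExpander G V0 V1 n d lam) (hconn : G.Connected)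
    (hlam : lam ≤ d / 200) {f : V → ℤ} (hf : IsHeight G f) {m : ℤ}
    (hlo : (n : ℝ) / 2 ≤ (V0.filter (fun v => f v ≤ m)).card)
    (hne : ∀ v ∈ V1, f v ≠ m)
    (hfew : ((V1.filter (fun v => f v ≤ m - 1)).card : ℝ) ≤ lam * n / d) :
    IsFlatAround f V1 (m + 1) (lam * n / d) := by
  have hn : (0 : ℝ) < n := by exact_mod_cast hG.n_pos hconn
  have hd : (0 : ℝ) < d := by exact_mod_cast hG.d_pos hconn
  have hl := hG.lam_nonneg hconn
  have hδ : 0 ≤ lam * n / d := by positivity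
  have hδ1 : lam * n / d ≤ n / 200 := by
    rw [div_le_iff₀ hd]; nlinarith
  have q1 := hG.card_mul_card_le_of_gap hconn hf (filter_subset (fun v => f v ≤ m) V0)
    (filter_subset (fun v => m + 2 ≤ f v) V1) (by simp only [mem_filter]; intros; omega)
  have q2 := hG.card_mul_card_le_of_gap hconn hf (filter_subset (fun v => f v ≤ m - 1) V0)
    (filter_subset (fun v => m + 1 ≤ f v) V1) (by simp only [mem_filter]; intros; omega)
  have q3 := hG.card_mul_card_le_of_gap hconn hf (filter_subset (fun v => m + 3 ≤ f v) V0)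
    (filter_subset (fun v => f v ≤ m + 1) V1) (by simp only [mem_filter]; intros; omega)
  set δ := lam * n / d
  have sz : (V1.card : ℝ) = n := by exact_mod_cast hG.2.2.1
  have c1 : (n : ℝ) ≤ (V1.filter (fun v => f v ≤ m - 1)).card +
      (V1.filter (fun v => m + 1 ≤ f v)).card := by
    rw [← sz]
    norm_cast
    refine (card_le_card ?_).trans (card_union_le _ _)
    intro v hv
    have := hne v hv
    simp only [mem_union, mem_filter]
    rcases lt_or_gt_of_ne this with h | h
    · left; exact ⟨hv, by omega⟩
    · right; exact ⟨hv, by omega⟩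
  have c2 : (n : ℝ) ≤ (V1.filter (fun v => f v ≤ m + 1)).card +
      (V1.filter (fun v => m + 2 ≤ f v)).card := by
    rw [← sz]
    norm_cast
    refine (card_le_card ?_).trans (card_union_le _ _)
    intro v hv
    simp only [mem_union, mem_filter]
    by_cases h : f v ≤ m + 1
    · left; exact ⟨hv, h⟩
    · right; exact ⟨hv, by omega⟩
  have c3 : ((V1.filter (fun v => f v ≠ m + 1)).card : ℝ) ≤
      (V1.filter (fun v => f v ≤ m - 1)).card + (V1.filter (fun v => m + 2 ≤ f v)).card := by
    norm_cast
    refine (card_le_card ?_).trans (card_union_le _ _)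
    intro v hv
    simp only [mem_union, mem_filter] at hv ⊢
    have := hne v hv.1
    have := hv.2
    by_cases h : f v ≤ m - 1
    · left; exact ⟨hv.1, h⟩
    · right; exact ⟨hv.1, by omega⟩
  have c4 : ((univ.filter (fun v => 2 ≤ |f v - (m + 1)|)).card : ℝ) ≤
      (V1.filter (fun v => f v ≠ m + 1)).card + ((V0.filter (fun v => f v ≤ m - 1)).card
        + (V0.filter (fun v => m + 3 ≤ f v)).card) := by
    norm_cast
    refine (card_le_card (t := _ ∪ (_ ∪ _)) ?_).trans
      ((card_union_le _ _).trans (Nat.add_le_add_left (card_union_le _ _) _))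
    intro v hv
    simp only [mem_union, mem_filter, mem_univ, true_and] at hv ⊢
    rcases le_abs.1 hv with h | h <;> rcases hG.2.2.2.1 v with hv' | hv'
    · right; right; exact ⟨hv', by omega⟩
    · left; exact ⟨hv', by omega⟩
    · right; left; exact ⟨hv', by omega⟩
    · left; exact ⟨hv', by omega⟩
  have aux : ∀ x y : ℝ, 0 ≤ y → (n : ℝ) / 2 ≤ x → x * y ≤ δ ^ 2 → y ≤ δ / 10 := by
    intro x y hy hx hxy
    have h1 : (n : ℝ) / 2 * y ≤ n / 2 * (δ / 10) := by nlinarith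
    exact le_of_mul_le_mul_left h1 (by positivity)
  have r1 := aux _ _ (Nat.cast_nonneg _) hlo q1
  have r2 := aux _ _ (Nat.cast_nonneg _) (by linarith) ((mul_comm _ _).trans_le q2)
  have r3 := aux _ _ (Nat.cast_nonneg _) (by linarith) ((mul_comm _ _).trans_le q3)
  exact ⟨by linarith, by linarith⟩

theorem exists_isFlatAround (hG : IsBiExpander G V0 V1 n d lam) (hconn : G.Connected)
    (hlam : lam ≤ d / 200) {f : V → ℤ} (hf : IsHeight G f) :
    ∃ (W : Finset V) (c : ℤ), (W = V0 ∨ W = V1) ∧ IsFlatAround f W c (lam * n / d) := by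
  have hn : (0 : ℝ) < n := by exact_mod_cast hG.n_pos hconn
  have hd : (0 : ℝ) < d := by exact_mod_cast hG.d_pos hconn
  have hl := hG.lam_nonneg hconn
  have hδ : 0 ≤ lam * n / d := by positivity
  have hδ1 : lam * n / d ≤ n / 200 := by
    rw [div_le_iff₀ hd]; nlinarith
  have sz : V0.card = n := hG.2.1
  obtain ⟨m, ⟨x, hx, hxm⟩, hlo, hhi⟩ := exists_median f (W := V0)
    (Finset.card_pos.1 (sz ▸ hG.n_pos hconn))
  rw [sz] at hlo hhi
  have hne : ∀ v ∈ V1, f v ≠ m := by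
    intro v hv h
    have := parity_eq hG hconn hf x v
    rw [if_pos hx, if_neg (hG.notMem_left hv)] at this
    omega
  by_cases hQ : ((V1.filter (fun v => f v ≤ m - 1)).card : ℝ) ≤ lam * n / d
  · exact ⟨V1, m + 1, Or.inr rfl, flat_of_median_of_few_below hG hconn hlam hf hlo hne hQ⟩
  by_cases hP : ((V1.filter (fun v => m + 1 ≤ f v)).card : ℝ) ≤ lam * n / d
  · refine ⟨V1, -(-m + 1), Or.inr rfl, IsFlatAround.of_neg ?_⟩
    refine flat_of_median_of_few_below hG hconn hlam (f := fun v => -f v)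
      (by simpa using hf.const_sub 0) ?_ ?_ ?_
    · simpa only [neg_le_neg_iff] using hhi
    · intro v hv h
      exact hne v hv (by omega)
    · have e : ∀ v, -f v ≤ -m - 1 ↔ m + 1 ≤ f v := fun v => by omega
      simpa only [e] using hP
  refine ⟨V0, m, Or.inl rfl, ?_⟩
  push Not at hP hQ
  have q1 := hG.card_mul_card_le_of_gap hconn hf (filter_subset (fun v => f v ≤ m) V0)
    (filter_subset (fun v => m + 2 ≤ f v) V1) (by simp only [mem_filter]; intros; omega)
  have q2 := hG.card_mul_card_le_of_gap hconn hf (filter_subset (fun v => m ≤ f v) V0)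
    (filter_subset (fun v => f v ≤ m - 2) V1) (by simp only [mem_filter]; intros; omega)
  have q3 := hG.card_mul_card_le_of_gap hconn hf (filter_subset (fun v => m + 1 ≤ f v) V0)
    (filter_subset (fun v => f v ≤ m - 1) V1) (by simp only [mem_filter]; intros; omega)
  have q4 := hG.card_mul_card_le_of_gap hconn hf (filter_subset (fun v => f v ≤ m - 1) V0)
    (filter_subset (fun v => m + 1 ≤ f v) V1) (by simp only [mem_filter]; intros; omega)
  set δ := lam * n / d
  have aux : ∀ x y : ℝ, 0 ≤ y → (n : ℝ) / 2 ≤ x → x * y ≤ δ ^ 2 → y ≤ δ / 10 := by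
    intro x y hy hx hxy
    have h1 : (n : ℝ) / 2 * y ≤ n / 2 * (δ / 10) := by nlinarith
    exact le_of_mul_le_mul_left h1 (by positivity)
  have aux2 : ∀ x y : ℝ, δ < y → x * y ≤ δ ^ 2 → x ≤ δ := by
    intro x y hy hxy
    by_contra! h
    nlinarith
  have r1 := aux _ _ (Nat.cast_nonneg _) hlo q1
  have r2 := aux _ _ (Nat.cast_nonneg _) hhi q2
  have r3 := aux2 _ _ hQ q3
  have r4 := aux2 _ _ hP q4
  have c3 : ((V0.filter (fun v => f v ≠ m)).card : ℝ) ≤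
      (V0.filter (fun v => f v ≤ m - 1)).card + (V0.filter (fun v => m + 1 ≤ f v)).card := by
    norm_cast
    refine (card_le_card ?_).trans (card_union_le _ _)
    intro v hv
    simp only [mem_union, mem_filter] at hv ⊢
    have := hv.2
    by_cases h : f v ≤ m - 1
    · left; exact ⟨hv.1, h⟩
    · right; exact ⟨hv.1, by omega⟩
  have c4 : ((univ.filter (fun v => 2 ≤ |f v - m|)).card : ℝ) ≤
      (V0.filter (fun v => f v ≠ m)).card + ((V1.filter (fun v => m + 2 ≤ f v)).card
        + (V1.filter (fun v => f v ≤ m - 2)).card) := by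
    norm_cast
    refine (card_le_card (t := _ ∪ (_ ∪ _)) ?_).trans
      ((card_union_le _ _).trans (Nat.add_le_add_left (card_union_le _ _) _))
    intro v hv
    simp only [mem_union, mem_filter, mem_univ, true_and] at hv ⊢
    rcases le_abs.1 hv with h | h <;> rcases hG.2.2.2.1 v with hv' | hv'
    · left; exact ⟨hv', by omega⟩
    · right; left; exact ⟨hv', by omega⟩
    · left; exact ⟨hv', by omega⟩
    · right; right; exact ⟨hv', by omega⟩
  exact ⟨by linarith, by linarith⟩

end Flatness

section ConnectedSets

variable {α : Type*} [DecidableEq α]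

/-- Tails of the walks of a given length that start at a given point and follow `nb`. -/
def walkTails (nb : α → Finset α) : ℕ → α → Finset (List α)
  | 0, _ => {[]}
  | L + 1, r => (nb r).biUnion fun b => (walkTails nb L b).image (List.cons b)

theorem card_walkTails_le (nb : α → Finset α) {D : ℕ} (hD : ∀ a, (nb a).card ≤ D) (L : ℕ)
    (r : α) : (walkTails nb L r).card ≤ D ^ L := by
  induction L generalizing r with
  | zero => simp [walkTails]
  | succ L ih =>
    rw [walkTails, pow_succ']
    refine card_biUnion_le.trans ?_
    calc ∑ b ∈ nb r, ((walkTails nb L b).image (List.cons b)).card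
        ≤ ∑ b ∈ nb r, D ^ L := sum_le_sum fun b _ => card_image_le.trans (ih b)
      _ = (nb r).card * D ^ L := by rw [sum_const, smul_eq_mul]
      _ ≤ D * D ^ L := Nat.mul_le_mul_right _ (hD r)

theorem mem_walkTails (nb : α → Finset α) (l : List α) (r : α)
    (h : List.IsChain (fun a b => b ∈ nb a) (r :: l)) : l ∈ walkTails nb l.length r := by
  induction l generalizing r with
  | nil => simp [walkTails]
  | cons b l ih =>
    rw [List.isChain_cons_cons] at h
    simp only [List.length_cons, walkTails, mem_biUnion, mem_image]
    exact ⟨b, h.1, l, ih b h.2, rfl⟩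

/-- A connected set with `k + 1` points contains the trace of a walk of length `2 * k` visiting
`k + 1` points. -/
theorem exists_chain_cover {R : α → α → Prop} (hR : ∀ a b, R a b → R b a) {A : Finset α} {r : α}
    (hr : r ∈ A) (hA : ∀ x ∈ A, Relation.ReflTransGen (fun a b => R a b ∧ b ∈ A) r x) (k : ℕ)
    (hk : k < A.card) :
    ∃ l : List α, l.head? = some r ∧ l.length = 2 * k + 1 ∧ l.IsChain R ∧ l.toFinset ⊆ A ∧
      l.toFinset.card = k + 1 := by
  induction k with
  | zero => exact ⟨[r], by simp [hr]⟩
  | succ k ih =>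
    obtain ⟨l, hhead, hlen, hchain, hsub, hcard⟩ := ih (by omega)
    have hrl : r ∈ l.toFinset := by
      rw [List.mem_toFinset]; exact List.mem_of_mem_head? hhead
    obtain ⟨a, ha, b, hb, hbl, hab⟩ : ∃ a ∈ l.toFinset, ∃ b ∈ A, b ∉ l.toFinset ∧ R a b := by
      by_contra! hcon
      have : A ⊆ l.toFinset := by
        intro x hx
        induction hA x hx with
        | refl => exact hrl
        | @tail y z _ hyz ih =>
          by_contra hz
          exact hcon y (ih (by
            rcases ‹Relation.ReflTransGen _ r y›.cases_tail with h | ⟨_, _, h⟩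
            · exact h ▸ hr
            · exact h.2)) z hyz.2 hz hyz.1
      have := card_le_card this
      omega
    obtain ⟨l₁, l₂, rfl⟩ := List.append_of_mem (List.mem_toFinset.1 ha)
    have hset : (l₁ ++ a :: b :: a :: l₂).toFinset = insert b (l₁ ++ a :: l₂).toFinset := by
      ext x
      simp only [List.mem_toFinset, mem_insert, List.mem_append, List.mem_cons]
      tauto
    refine ⟨l₁ ++ a :: b :: a :: l₂, ?_, ?_, ?_, ?_, ?_⟩
    · cases l₁ <;> simpa using hhead
    · simp only [List.length_append, List.length_cons] at hlen ⊢
      omega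
    · rw [List.isChain_split] at hchain ⊢
      refine ⟨hchain.1, ?_⟩
      rw [List.isChain_cons_cons, List.isChain_cons_cons]
      exact ⟨hab, hR _ _ hab, hchain.2⟩
    · rw [hset]
      exact insert_subset hb hsub
    · rw [hset, card_insert_of_notMem hbl, hcard]

theorem card_connected_sets_le (nb : α → Finset α) (hnb : ∀ a b, b ∈ nb a → a ∈ nb b) {D : ℕ}
    (hD : ∀ a, (nb a).card ≤ D) (r : α) (k : ℕ) (F : Finset (Finset α))
    (hF : ∀ A ∈ F, A.card = k + 1 ∧ r ∈ A ∧
      ∀ x ∈ A, Relation.ReflTransGen (fun a b => b ∈ nb a ∧ b ∈ A) r x) :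
    F.card ≤ D ^ (2 * k) := by
  have : F ⊆ (walkTails nb (2 * k) r).image fun l => (r :: l).toFinset := by
    intro A hA
    obtain ⟨hcard, hr, hconn⟩ := hF A hA
    obtain ⟨l, hhead, hlen, hchain, hsub, hl⟩ :=
      exists_chain_cover (R := fun a b => b ∈ nb a) hnb hr hconn k (by omega)
    rw [mem_image]
    cases l with
    | nil => simp at hhead
    | cons c l =>
      obtain rfl : c = r := by simpa using hhead
      refine ⟨l, ?_, eq_of_subset_of_card_le hsub (by omega)⟩
      have := mem_walkTails nb l c hchain
      rwa [show l.length = 2 * k by simpa using hlen] at this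
  exact (card_le_card this).trans (card_image_le.trans (card_walkTails_le nb hD _ _))

end ConnectedSets

section Reachability

variable {V : Type*} {G : SimpleGraph V} {V0 : Finset V} {g : V → ℤ} {v : V}

open Classical in
/-- The vertices of `W` reachable from `v` through vertices where `g` is positive. -/
noncomputable def cluster (G : SimpleGraph V) (W : Finset V) (g : V → ℤ) (v : V) : Finset V :=
  W.filter (Relation.ReflTransGen (fun x y => G.Adj x y ∧ 1 ≤ g y) v)

theorem reflTransGen_of_walk
    (hg : IsHeight G g) {a b : V} (p : G.Walk a b)
    (h : (p.length : ℤ) < g a) :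
    Relation.ReflTransGen (fun x y => G.Adj x y ∧ 1 ≤ g y) a b := by
  induction p with
  | nil => exact Relation.ReflTransGen.refl
  | @cons u w x huw p ih =>
    rw [SimpleGraph.Walk.length_cons] at h
    push_cast at h
    have hw : (p.length : ℤ) < g w := by rcases hg.cases huw with h' | h' <;> omega
    exact Relation.ReflTransGen.head ⟨huw, by omega⟩ (ih hw)

/-- `r` is a vertex of `V0` at distance at most one from `v`, equal to `v` if possible. -/
def IsRoot (G : SimpleGraph V) (V0 V1 : Finset V) (v r : V) : Prop :=
  v ∈ V0 ∧ r = v ∨ v ∈ V1 ∧ G.Adj v r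

theorem cluster_subset : cluster G V0 g v ⊆ V0 := by
  classical exact filter_subset _ _

theorem reach_of_mem_cluster {x : V} (hx : x ∈ cluster G V0 g v) :
    Relation.ReflTransGen (fun x y => G.Adj x y ∧ 1 ≤ g y) v x := by
  classical exact (mem_filter.1 hx).2

theorem mem_cluster {x : V} (hx : x ∈ V0)
    (h : Relation.ReflTransGen (fun x y => G.Adj x y ∧ 1 ≤ g y) v x) :
    x ∈ cluster G V0 g v := by
  classical exact mem_filter.2 ⟨hx, h⟩

theorem one_le_of_reach {x : V} (hv : 2 ≤ g v)
    (h : Relation.ReflTransGen (fun x y => G.Adj x y ∧ 1 ≤ g y) v x) : 1 ≤ g x := by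
  rcases h.cases_tail with h | ⟨_, _, h⟩
  · rw [h]; omega
  · exact h.2

end Reachability

section Clusters

variable {V : Type*} [Fintype V] {G : SimpleGraph V} [DecidableRel G.Adj]
  {V0 V1 : Finset V} {n d : ℕ} {lam : ℝ} {g : V → ℤ} {v r : V}

/-- Height functions vanishing on all but at most `2 * δ` vertices of the class `W`. -/
def groundHeights (G : SimpleGraph V) (W : Finset V) (δ : ℝ) : Set (V → ℤ) :=
  {g | IsHeight G g ∧ ((W.filter (fun v => g v ≠ 0)).card : ℝ) ≤ 2 * δ}

theorem root_mem_cluster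
    (hG : IsBiExpander G V0 V1 n d lam)
    (hg : g ∈ groundHeights G V0 (lam * n / d)) (hv : 2 ≤ g v)
    (hr : IsRoot G V0 V1 v r) : r ∈ cluster G V0 g v := by
  rcases hr with ⟨h, rfl⟩ | ⟨h, hvr⟩
  · exact mem_cluster h Relation.ReflTransGen.refl
  · refine mem_cluster (hG.mem_left h hvr) (Relation.ReflTransGen.single ⟨hvr, ?_⟩)
    rcases hg.1.cases hvr with h' | h' <;> omega

theorem cluster_connected
    (hG : IsBiExpander G V0 V1 n d lam)
    (hr : IsRoot G V0 V1 v r) {x : V} (hx : x ∈ cluster G V0 g v) :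
    Relation.ReflTransGen
      (fun a b => (∃ w, G.Adj a w ∧ G.Adj w b) ∧ b ∈ cluster G V0 g v) r x := by
  suffices h : ∀ u, Relation.ReflTransGen (fun x y => G.Adj x y ∧ 1 ≤ g y) v u →
      (u ∈ V0 → Relation.ReflTransGen
        (fun a b => (∃ w, G.Adj a w ∧ G.Adj w b) ∧ b ∈ cluster G V0 g v) r u) ∧
      (u ∈ V1 → ∀ x ∈ cluster G V0 g v, G.Adj u x → Relation.ReflTransGen
        (fun a b => (∃ w, G.Adj a w ∧ G.Adj w b) ∧ b ∈ cluster G V0 g v) r x) from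
    (h x (reach_of_mem_cluster hx)).1 (cluster_subset hx)
  intro u hu
  induction hu with
  | refl =>
    rcases hr with ⟨h, rfl⟩ | ⟨h, hvr⟩
    · exact ⟨fun _ => Relation.ReflTransGen.refl, fun h' => absurd h' (hG.notMem_right h)⟩
    · exact ⟨fun h' => absurd h' (hG.notMem_left h), fun _ x hx hvx =>
        Relation.ReflTransGen.single ⟨⟨v, hvr.symm, hvx⟩, hx⟩⟩
  | @tail y z hy hyz ih =>
    refine ⟨fun hz => ?_, fun hz x hx hzx => ?_⟩
    · exact ih.2 (hG.mem_right hz hyz.1.symm) z (mem_cluster hz (hy.tail hyz)) hyz.1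
    · exact (ih.1 (hG.mem_left hz hyz.1.symm)).tail ⟨⟨z, hyz.1, hzx⟩, hx⟩

variable [DecidableEq V]

/-- The vertices of `W` with a neighbour in `S`. -/
def nbhdIn (G : SimpleGraph V) [DecidableRel G.Adj] (W S : Finset V) : Finset V :=
  W.filter fun w => ∃ x ∈ S, G.Adj w x

/-- The vertices of `W` with a neighbour in `S` and a neighbour outside `S`. -/
def mixedBoundary (G : SimpleGraph V) [DecidableRel G.Adj] (W S : Finset V) : Finset V :=
  W.filter fun w => (∃ x ∈ S, G.Adj w x) ∧ ∃ x, x ∉ S ∧ G.Adj w x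

theorem even_of_mem_groundHeights (hG : IsBiExpander G V0 V1 n d lam) (hconn : G.Connected)
    (hlam : lam ≤ d / 200) (hg : g ∈ groundHeights G V0 (lam * n / d)) (y : V) :
    (g y + if y ∈ V0 then 0 else 1) % 2 = 0 := by
  have hn : (0 : ℝ) < n := by exact_mod_cast hG.n_pos hconn
  have hd : (0 : ℝ) < d := by exact_mod_cast hG.d_pos hconn
  have hδ1 : lam * n / d ≤ n / 200 := by
    rw [div_le_iff₀ hd]; nlinarith
  obtain ⟨x, hx, hx0⟩ : ∃ x ∈ V0, g x = 0 := by
    by_contra! h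
    have h2 := hg.2
    rw [filter_true_of_mem h, hG.2.1] at h2
    linarith
  have := parity_eq hG hconn hg.1 y x
  rwa [if_pos hx, hx0] at this

theorem card_mul_two_pow_mixedBoundary_le (hG : IsBiExpander G V0 V1 n d lam)
    (hconn : G.Connected) {δ : ℝ} {S : Finset V} (hS : S ⊆ V0) {F Ω : Finset (V → ℤ)}
    (hΩ : ∀ g, g ∈ Ω ↔ g ∈ groundHeights G V0 δ) (hF : F ⊆ Ω)
    (h1 : ∀ g ∈ F, ∀ w ∈ mixedBoundary G V1 S, g w = 1)
    (h0 : ∀ g ∈ F, ∀ w ∈ mixedBoundary G V1 S, ∀ x, x ∉ S → G.Adj w x → g x = 0)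
    (hagree : ∀ g ∈ F, ∀ g' ∈ F, ∀ x ∈ S, g x = g' x) :
    F.card * 2 ^ (mixedBoundary G V1 S).card ≤ Ω.card := by
  choose nb hnb using hG.exists_adj hconn
  set M := mixedBoundary G V1 S with hM
  have hMV : ∀ w ∈ M, w ∉ S := fun w hw hwS =>
    hG.notMem_left (mem_filter.1 hw).1 (hS hwS)
  let flip : (V → ℤ) × Finset V → V → ℤ := fun p u =>
    if u ∈ S then 0 else if u ∈ M then (if u ∈ p.2 then 1 else -1)
    else if ∀ x, G.Adj u x → x ∈ S then p.1 u - p.1 (nb u) else p.1 u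
  rw [← card_powerset, ← card_product]
  refine card_le_card_of_injOn flip ?_ ?_
  · rintro ⟨g, A⟩ hp
    obtain ⟨hgF, hA⟩ : g ∈ F ∧ A ⊆ M := by simpa using hp
    have hgΩ := (hΩ g).1 (hF hgF)
    rw [mem_coe, hΩ]
    have hVal : ∀ x ∈ V0, x ∉ S → flip (g, A) x = g x := by
      intro x hx hxS
      have hxM : x ∉ M := fun h => hG.notMem_right hx (mem_filter.1 h).1
      simp only [flip, if_neg hxS, if_neg hxM]
      rw [if_neg]
      intro hall
      exact hG.notMem_right (hS (hall _ (hnb x))) (hG.mem_right hx (hnb x))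
    have key : ∀ x ∈ V0, ∀ w ∈ V1, G.Adj x w → |flip (g, A) x - flip (g, A) w| = 1 := by
      intro x hx w hw hxw
      have hwS : w ∉ S := fun h => hG.notMem_left hw (hS h)
      by_cases hxS : x ∈ S
      · simp only [flip, if_pos hxS, if_neg hwS]
        by_cases hwM : w ∈ M
        · rw [if_pos hwM]
          split_ifs <;> simp
        · have hall : ∀ y, G.Adj w y → y ∈ S := by
            intro y hy
            by_contra hyS
            exact hwM (mem_filter.2 ⟨hw, ⟨x, hxS, hxw.symm⟩, y, hyS, hy⟩)
          rw [if_neg hwM, if_pos hall, zero_sub, abs_neg]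
          exact hgΩ.1 _ _ (hnb w)
      · rw [hVal x hx hxS]
        simp only [flip, if_neg hwS]
        by_cases hwM : w ∈ M
        · rw [if_pos hwM, h0 g hgF w hwM x hxS hxw.symm]
          split_ifs <;> simp
        · rw [if_neg hwM, if_neg (fun hall => hxS (hall x hxw.symm))]
          exact hgΩ.1 _ _ hxw
    refine ⟨?_, le_trans ?_ hgΩ.2⟩
    · intro u w huw
      rcases hG.2.2.2.2.2.1 u w huw with h | h
      · exact key u h.1 w h.2 huw
      · rw [abs_sub_comm]
        exact key w h.2 u h.1 huw.symm
    · norm_cast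
      refine card_le_card fun x hx => ?_
      rw [mem_filter] at hx ⊢
      refine ⟨hx.1, ?_⟩
      by_cases hxS : x ∈ S
      · exact absurd (by simp [flip, hxS]) hx.2
      · rw [← hVal x hx.1 hxS]; exact hx.2
  · rintro ⟨g, A⟩ hp ⟨g', A'⟩ hp' heq
    obtain ⟨hgF, hA⟩ : g ∈ F ∧ A ⊆ M := by simpa using hp
    obtain ⟨hgF', hA'⟩ : g' ∈ F ∧ A' ⊆ M := by simpa using hp'
    have heq' : ∀ u, flip (g, A) u = flip (g', A') u := fun u => congrFun heq u
    have e1 : g = g' := by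
      funext u
      by_cases huS : u ∈ S
      · exact hagree g hgF g' hgF' u huS
      by_cases huM : u ∈ M
      · rw [h1 g hgF u huM, h1 g' hgF' u huM]
      have h := heq' u
      simp only [flip, if_neg huS, if_neg huM] at h
      split_ifs at h with hall
      · have := hagree g hgF g' hgF' _ (hall _ (hnb u))
        linarith
      · exact h
    have e2 : A = A' := by
      ext u
      by_cases huM : u ∈ M
      · have h := heq' u
        simp only [flip, if_neg (hMV u huM), if_pos huM] at h
        by_cases ha : u ∈ A <;> by_cases ha' : u ∈ A' <;> simp [ha, ha'] at h ⊢
      · exact ⟨fun h => absurd (hA h) huM, fun h => absurd (hA' h) huM⟩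
    rw [e1, e2]

theorem two_le_of_mem_cluster
    (hG : IsBiExpander G V0 V1 n d lam) (hconn : G.Connected)
    (hlam : lam ≤ d / 200) (hg : g ∈ groundHeights G V0 (lam * n / d)) (hv : 2 ≤ g v)
    {x : V} (hx : x ∈ cluster G V0 g v) : 2 ≤ g x := by
  have h1 := one_le_of_reach hv (reach_of_mem_cluster hx)
  have h2 := even_of_mem_groundHeights hG hconn hlam hg x
  rw [if_pos (cluster_subset hx)] at h2
  omega

theorem reach_of_adj_cluster
    (hG : IsBiExpander G V0 V1 n d lam) (hconn : G.Connected)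
    (hlam : lam ≤ d / 200) (hg : g ∈ groundHeights G V0 (lam * n / d)) (hv : 2 ≤ g v)
    {x w : V} (hx : x ∈ cluster G V0 g v) (h : G.Adj x w) :
    Relation.ReflTransGen (fun x y => G.Adj x y ∧ 1 ≤ g y) v w := by
  refine (reach_of_mem_cluster hx).tail ⟨h, ?_⟩
  have := two_le_of_mem_cluster hG hconn hlam hg hv hx
  rcases hg.1.cases h with h' | h' <;> omega

theorem card_cluster_le
    (hG : IsBiExpander G V0 V1 n d lam) (hconn : G.Connected)
    (hlam : lam ≤ d / 200) (hg : g ∈ groundHeights G V0 (lam * n / d)) (hv : 2 ≤ g v)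
    : ((cluster G V0 g v).card : ℝ) ≤ 2 * (lam * n / d) := by
  refine le_trans ?_ hg.2
  norm_cast
  refine card_le_card fun x hx => mem_filter.2 ⟨cluster_subset hx, ?_⟩
  have := two_le_of_mem_cluster hG hconn hlam hg hv hx
  omega

theorem values_at_mixedBoundary
    (hG : IsBiExpander G V0 V1 n d lam) (hconn : G.Connected)
    (hlam : lam ≤ d / 200) (hg : g ∈ groundHeights G V0 (lam * n / d)) (hv : 2 ≤ g v)
    {w : V} (hw : w ∈ mixedBoundary G V1 (cluster G V0 g v)) :
    g w = 1 ∧ (∀ x, x ∉ cluster G V0 g v → G.Adj w x → g x = 0) ∧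
      ∀ x ∈ cluster G V0 g v, G.Adj w x → g x = 2 := by
  obtain ⟨hw1, ⟨x, hx, hwx⟩, y, hy, hwy⟩ := mem_filter.1 hw
  have hreach := reach_of_adj_cluster hG hconn hlam hg hv hx hwx.symm
  have hw0 := one_le_of_reach hv hreach
  have hout : ∀ z, z ∉ cluster G V0 g v → G.Adj w z → g z ≤ 0 := by
    intro z hz hwz
    by_contra! h
    exact hz (mem_cluster (hG.mem_left hw1 hwz) (hreach.tail ⟨hwz, by omega⟩))
  have hgw : g w = 1 := by
    have := hout y hy hwy
    rcases hg.1.cases hwy with h' | h' <;> omega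
  refine ⟨hgw, fun z hz hwz => ?_, fun z hz hwz => ?_⟩
  · have := hout z hz hwz
    rcases hg.1.cases hwz with h' | h' <;> omega
  · have := two_le_of_mem_cluster hG hconn hlam hg hv hz
    rcases hg.1.cases hwz with h' | h' <;> omega

theorem gBall_subset_cluster
    (hG : IsBiExpander G V0 V1 n d lam) (hconn : G.Connected)
    (hg : g ∈ groundHeights G V0 (lam * n / d)) (hv : 2 ≤ g v)
    {t : ℕ} (ht : (t : ℤ) < g v) :
    gBall G v t ⊆ ↑(cluster G V0 g v ∪ nbhdIn G V1 (cluster G V0 g v)) := by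
  intro u ⟨hreach, hdist⟩
  obtain ⟨p, hp⟩ := hreach.exists_walk_length_eq_dist
  have h := reflTransGen_of_walk hg.1 p (by rw [hp]; omega)
  rw [coe_union, Set.mem_union, mem_coe, mem_coe]
  rcases hG.2.2.2.1 u with hu | hu
  · exact Or.inl (mem_cluster hu h)
  · refine Or.inr (mem_filter.2 ⟨hu, ?_⟩)
    rcases h.cases_tail with rfl | ⟨y, hy, hyu⟩
    · obtain ⟨r, hr⟩ := hG.exists_adj hconn u
      exact ⟨r, root_mem_cluster hG hg hv (Or.inr ⟨hu, hr⟩), hr⟩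
    · exact ⟨y, mem_cluster (hG.mem_left hu hyu.1.symm) hy, hyu.1.symm⟩

end Clusters

theorem lam_le_of_log {d : ℕ} {lam : ℝ} (hlam : lam ≤ (d : ℝ) / (300 * Real.log d)) :
    lam ≤ d / 200 := by
  rcases lt_or_ge d 2 with h | h
  · have : Real.log d = 0 := by
      interval_cases d <;> simp
    rw [this, mul_zero, div_zero] at hlam
    exact hlam.trans (by positivity)
  · refine hlam.trans ?_
    have h2 : Real.log 2 ≤ Real.log d := Real.log_le_log (by norm_num) (by exact_mod_cast h)
    have := Real.log_two_gt_d9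
    gcongr
    linarith

theorem sum_inv_eight_pow_le (K : ℕ) :
    ∑ k ∈ range K, (1 / 8 : ℝ) ^ (k + 1) ≤ 1 / 4 := by
  have h : ∑ k ∈ range K, (1 / 8 : ℝ) ^ (k + 1) = 1 / 7 - (1 / 7) * (1 / 8) ^ K := by
    induction K with
    | zero => simp
    | succ K ih => rw [sum_range_succ, ih]; ring
  have : (0 : ℝ) ≤ (1 / 8) ^ K := by positivity
  rw [h]
  linarith

theorem finite_homSet {V : Type*} [Fintype V] [DecidableEq V] {G : SimpleGraph V}
    (hconn : G.Connected) (v₀ : V) : (HomSet G v₀).Finite := by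
  refine (Set.finite_Icc (fun _ => -(Fintype.card V : ℤ)) fun _ => (Fintype.card V : ℤ)).subset ?_
  rintro f ⟨h0, hf⟩
  have key : ∀ {a b : V} (p : G.Walk a b), |f a - f b| ≤ p.length := by
    intro a b p
    induction p with
    | nil => simp
    | @cons u v w h p ih =>
      rw [SimpleGraph.Walk.length_cons]
      have := abs_sub_le (f u) (f v) (f w)
      have := hf u v h
      push_cast
      omega
  have hb : ∀ v, |f v| ≤ Fintype.card V := by
    intro v
    obtain ⟨p, hp⟩ := (hconn.preconnected v v₀).exists_isPath
    have h1 := key p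
    have h2 := hp.length_lt
    rw [h0, sub_zero] at h1
    omega
  exact ⟨fun v => (abs_le.1 (hb v)).1, fun v => (abs_le.1 (hb v)).2⟩

section ClusterCode

variable {V : Type*} [DecidableEq V] {G : SimpleGraph V} {V0 : Finset V}

/-- The cluster of `v` together with the heights on it relative to the height of `r`. -/
noncomputable def clusterCode (G : SimpleGraph V) (W : Finset V) (v r : V) (g : V → ℤ) :
    Finset (V × ℤ) :=
  (cluster G W g v).image fun x => (x, g x - g r)

theorem mem_clusterCode {W : Finset V} {v r : V} {g : V → ℤ} {p : V × ℤ} :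
    p ∈ clusterCode G W v r g ↔ p.1 ∈ cluster G W g v ∧ p.2 = g p.1 - g r := by
  rw [clusterCode, mem_image]
  constructor
  · rintro ⟨x, hx, rfl⟩
    exact ⟨hx, rfl⟩
  · rintro ⟨h1, h2⟩
    exact ⟨p.1, h1, by rw [← h2]⟩

theorem card_clusterCode {W : Finset V} {v r : V} {g : V → ℤ} :
    (clusterCode G W v r g).card = (cluster G W g v).card :=
  card_image_of_injective _ fun _ _ h => (Prod.mk.inj h).1

theorem cluster_eq_of_clusterCode_eq {v r : V} {g g' : V → ℤ}
    (h : clusterCode G V0 v r g = clusterCode G V0 v r g') :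
    cluster G V0 g v = cluster G V0 g' v := by
  have e : ∀ g, (clusterCode G V0 v r g).image Prod.fst = cluster G V0 g v := by
    intro g
    rw [clusterCode, image_image]
    exact image_id
  rw [← e g, ← e g', h]

end ClusterCode

section Counting

variable {V : Type*} [Fintype V] [DecidableEq V] {G : SimpleGraph V} [DecidableRel G.Adj]
  {V0 V1 : Finset V} {n d : ℕ} {lam : ℝ}

/-- The entropy gained on the mixed boundary of a small set dominates the entropy of the set. -/
theorem exp_mul_pow_le_two_pow_mixedBoundary (hG : IsBiExpander G V0 V1 n d lam)
    (hconn : G.Connected) (hlam : lam ≤ (d : ℝ) / (300 * Real.log d)) {S : Finset V}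
    (hS : S ⊆ V0) (hne : S.Nonempty) (hcard : (S.card : ℝ) ≤ 2 * (lam * n / d)) :
    Real.exp (((S ∪ nbhdIn G V1 S).card : ℝ) / 3) *
        (((3 * d ^ 2 : ℕ) : ℝ) ^ (2 * S.card) * 8 ^ S.card) ≤
      2 ^ (mixedBoundary G V1 S).card := by
  have hn : (0 : ℝ) < n := by exact_mod_cast hG.n_pos hconn
  have hd : (0 : ℝ) < d := by exact_mod_cast hG.d_pos hconn
  have hlam0 := hG.lam_nonneg hconn
  have hlam' := lam_le_of_log hlam
  have hs1 : (1 : ℝ) ≤ S.card := by exact_mod_cast hne.card_pos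
  have hlpos : 0 < lam := by
    rcases hlam0.eq_or_lt with h | h
    · rw [← h] at hcard
      simp at hcard
      simp [hcard] at hne
    · exact h
  have hlogpos : 0 < Real.log d := by
    by_contra! h
    have : (d : ℝ) / (300 * Real.log d) ≤ 0 :=
      div_nonpos_of_nonneg_of_nonpos hd.le (by linarith)
    linarith
  have hd2 : (2 : ℝ) ≤ d := by
    have : (1 : ℝ) < d := (Real.log_pos_iff hd.le).1 hlogpos
    exact_mod_cast this
  have hlog2 : Real.log 2 ≤ Real.log d := Real.log_le_log (by norm_num) hd2
  have hN : (S.card : ℝ) ≤ 4 * (lam / d) * (nbhdIn G V1 S).card := by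
    refine hG.card_le_four_mul hconn hlam' hS (filter_subset _ _) ?_ hcard
    intro a ha b hab
    exact mem_filter.2 ⟨hG.mem_right (hS ha) hab, a, ha, hab.symm⟩
  have hN2 : 75 * S.card * Real.log d ≤ (nbhdIn G V1 S).card := by
    have h1 : lam / d * Real.log d ≤ 1 / 300 := by
      rw [le_div_iff₀ (by positivity)] at hlam
      rw [div_mul_eq_mul_div, div_le_iff₀ hd]
      linarith
    have h2 : (0 : ℝ) ≤ (nbhdIn G V1 S).card := Nat.cast_nonneg _
    nlinarith
  have hT : (((nbhdIn G V1 S) \ mixedBoundary G V1 S).card : ℝ) ≤ S.card := by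
    refine hG.card_interior_le hconn hlam' hS
      (sdiff_subset.trans (filter_subset _ _)) ?_ hcard
    intro b hb a hab
    rw [mem_sdiff] at hb
    obtain ⟨hb1, hb2⟩ := mem_filter.1 hb.1
    by_contra ha
    exact hb.2 (mem_filter.2 ⟨hb1, hb2, a, ha, hab⟩)
  have hM : ((nbhdIn G V1 S).card : ℝ) ≤ (mixedBoundary G V1 S).card + S.card := by
    have : ((nbhdIn G V1 S).card : ℝ) ≤ (mixedBoundary G V1 S).card +
        ((nbhdIn G V1 S) \ mixedBoundary G V1 S).card := by
      norm_cast
      have := card_le_card_sdiff_add_card (s := nbhdIn G V1 S) (t := mixedBoundary G V1 S)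
      omega
    linarith
  have hU : ((S ∪ nbhdIn G V1 S).card : ℝ) ≤ S.card + (nbhdIn G V1 S).card := by
    exact_mod_cast card_union_le _ _
  have e1 : (((3 * d ^ 2 : ℕ) : ℝ) ^ (2 * S.card) * 8 ^ S.card) ≤
      Real.exp (S.card * (7 * Real.log 2 + 4 * Real.log d)) := by
    have : Real.exp (S.card * (7 * Real.log 2 + 4 * Real.log d)) =
        ((4 * d ^ 2 : ℝ) ^ (2 * S.card) * 8 ^ S.card) := by
      rw [Real.exp_nat_mul, Real.exp_add,
        show 7 * Real.log 2 = ((7 : ℕ) : ℝ) * Real.log 2 by norm_num,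
        show 4 * Real.log d = ((4 : ℕ) : ℝ) * Real.log d by norm_num,
        Real.exp_nat_mul, Real.exp_nat_mul, Real.exp_log (by norm_num), Real.exp_log hd, pow_mul,
        ← mul_pow]
      congr 1
      ring
    rw [this]
    push_cast
    gcongr
    norm_num
  have e2 : (2 : ℝ) ^ (mixedBoundary G V1 S).card =
      Real.exp ((mixedBoundary G V1 S).card * Real.log 2) := by
    rw [Real.exp_nat_mul, Real.exp_log (by norm_num)]
  rw [e2]
  refine (mul_le_mul_of_nonneg_left e1 (Real.exp_pos _).le).trans ?_
  rw [← Real.exp_add, Real.exp_le_exp]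
  have l1 := Real.log_two_gt_d9
  have l2 := Real.log_two_lt_d9
  set s : ℝ := (S.card : ℝ)
  set ℓ := Real.log d
  set N : ℝ := ((nbhdIn G V1 S).card : ℝ)
  set M : ℝ := ((mixedBoundary G V1 S).card : ℝ)
  have m1 : (N - s) * Real.log 2 ≤ M * Real.log 2 :=
    mul_le_mul_of_nonneg_right (by linarith) (by linarith)
  have m2 : 0.6931 * (s * 1) ≤ s * ℓ := by nlinarith
  have hsl : 0 ≤ s * ℓ := by positivity
  have hN0 : 0 ≤ N := Nat.cast_nonneg _
  have m3 : 0.693 * N ≤ N * Real.log 2 := by nlinarith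
  have m4 : s * Real.log 2 ≤ 0.6932 * s := by nlinarith
  nlinarith

/-- Neighbours in the graph of height functions restricted to one class: the vertex moves along
two edges. -/
def heightNbrs (G : SimpleGraph V) [DecidableRel G.Adj] (p : V × ℤ) : Finset (V × ℤ) :=
  ((G.neighborFinset p.1).biUnion fun w => G.neighborFinset w) ×ˢ {p.2 - 2, p.2, p.2 + 2}

theorem mem_heightNbrs {p q : V × ℤ} :
    q ∈ heightNbrs G p ↔ (∃ w, G.Adj p.1 w ∧ G.Adj w q.1) ∧
      (q.2 = p.2 - 2 ∨ q.2 = p.2 ∨ q.2 = p.2 + 2) := by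
  simp [heightNbrs]

theorem card_heightNbrs_le (hG : IsBiExpander G V0 V1 n d lam) (p : V × ℤ) :
    (heightNbrs G p).card ≤ 3 * d ^ 2 := by
  rw [heightNbrs, card_product]
  have h1 : ((G.neighborFinset p.1).biUnion fun w => G.neighborFinset w).card ≤ d * d := by
    refine (card_biUnion_le_card_mul _ _ d fun w _ => ?_).trans ?_
    · rw [SimpleGraph.card_neighborFinset_eq_degree, hG.2.2.2.2.2.2.1]
    · rw [SimpleGraph.card_neighborFinset_eq_degree, hG.2.2.2.2.2.2.1]
  have h2 : ({p.2 - 2, p.2, p.2 + 2} : Finset ℤ).card ≤ 3 := card_le_three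
  calc _ ≤ d * d * 3 := Nat.mul_le_mul h1 h2
    _ = _ := by ring

theorem clusterCode_connected (hG : IsBiExpander G V0 V1 n d lam) {v r : V} {g : V → ℤ}
    (hg : IsHeight G g) (hr : IsRoot G V0 V1 v r) {p : V × ℤ}
    (hp : p ∈ clusterCode G V0 v r g) :
    Relation.ReflTransGen (fun a b => b ∈ heightNbrs G a ∧ b ∈ clusterCode G V0 v r g)
      (r, 0) p := by
  obtain ⟨x, a⟩ := p
  obtain ⟨hx, ha⟩ := mem_clusterCode.1 hp
  have h := cluster_connected hG hr hx
  simp only at ha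
  rw [ha, ← sub_self (g r)]
  refine Relation.ReflTransGen.lift (fun y => (y, g y - g r)) ?_ _ _ h
  rintro y z ⟨⟨w, hyw, hwz⟩, hz⟩
  refine ⟨mem_heightNbrs.2 ⟨⟨w, hyw, hwz⟩, ?_⟩, mem_clusterCode.2 ⟨hz, rfl⟩⟩
  simp only
  rcases hg.cases hyw with h1 | h1 <;> rcases hg.cases hwz with h2 | h2 <;> omega

/-- Height functions sharing a cluster code form a small fraction of all height functions. -/
theorem card_fiber_mul_two_pow_le (hG : IsBiExpander G V0 V1 n d lam) (hconn : G.Connected)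
    (hlam : lam ≤ d / 200) {v r : V} {Ω F : Finset (V → ℤ)} {S : Finset V}
    {C : Finset (V × ℤ)} (hΩ : ∀ g, g ∈ Ω ↔ g ∈ groundHeights G V0 (lam * n / d))
    (hF : ∀ g ∈ F, g ∈ Ω ∧ 2 ≤ g v ∧ clusterCode G V0 v r g = C ∧ cluster G V0 g v = S)
    (hS : S ⊆ V0) (hM : (mixedBoundary G V1 S).Nonempty) :
    F.card * 2 ^ (mixedBoundary G V1 S).card ≤ Ω.card := by
  have hval : ∀ g ∈ F, ∀ w ∈ mixedBoundary G V1 S,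
      g w = 1 ∧ (∀ x, x ∉ S → G.Adj w x → g x = 0) ∧ ∀ x ∈ S, G.Adj w x → g x = 2 := by
    intro g hg w hw
    obtain ⟨h1, h2, -, h4⟩ := hF g hg
    rw [← h4] at hw ⊢
    exact values_at_mixedBoundary hG hconn hlam ((hΩ g).1 h1) h2 hw
  refine card_mul_two_pow_mixedBoundary_le hG hconn hS hΩ (fun g hg => (hF g hg).1)
    (fun g hg w hw => (hval g hg w hw).1) (fun g hg w hw => (hval g hg w hw).2.1) ?_
  obtain ⟨w, hw⟩ := hM
  obtain ⟨-, ⟨y, hy, hwy⟩, -⟩ := mem_filter.1 hw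
  intro g hg g' hg' x hx
  have hdiff : ∀ z ∈ S, g z - g r = g' z - g' r := by
    intro z hz
    have h : (z, g z - g r) ∈ clusterCode G V0 v r g :=
      mem_clusterCode.2 ⟨by rw [(hF g hg).2.2.2]; exact hz, rfl⟩
    rw [(hF g hg).2.2.1, ← (hF g' hg').2.2.1] at h
    exact (mem_clusterCode.1 h).2
  have h1 := (hval g hg w hw).2.2 y hy hwy
  have h2 := (hval g' hg' w hw).2.2 y hy hwy
  have := hdiff x hx
  have := hdiff y hy
  omega

theorem card_lt_height_le (hG : IsBiExpander G V0 V1 n d lam) (hconn : G.Connected)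
    (hlam : lam ≤ (d : ℝ) / (300 * Real.log d)) {Ω : Finset (V → ℤ)}
    (hΩ : ∀ g, g ∈ Ω ↔ g ∈ groundHeights G V0 (lam * n / d)) (v : V) {t : ℕ} (ht : 1 ≤ t) :
    ((Ω.filter fun g => (t : ℤ) < g v).card : ℝ) ≤
      1 / 4 * (Real.exp (-((gBall G v t).ncard : ℝ) / 3) * Ω.card) := by
  have hlam' := lam_le_of_log hlam
  have hd : 0 < d := hG.d_pos hconn
  obtain ⟨r, hr⟩ : ∃ r, IsRoot G V0 V1 v r := by
    rcases hG.2.2.2.1 v with h | h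
    · exact ⟨v, Or.inl ⟨h, rfl⟩⟩
    · obtain ⟨r, hr⟩ := hG.exists_adj hconn v
      exact ⟨r, Or.inr ⟨h, hr⟩⟩
  set B := Ω.filter fun g => (t : ℤ) < g v with hB
  have hBprop : ∀ g ∈ B, g ∈ groundHeights G V0 (lam * n / d) ∧ 2 ≤ g v ∧ (t : ℤ) < g v := by
    intro g hg
    obtain ⟨h1, h2⟩ := mem_filter.1 hg
    exact ⟨(hΩ g).1 h1, by omega, h2⟩
  set E := Real.exp (-((gBall G v t).ncard : ℝ) / 3) with hE
  have hEpos : 0 < E := Real.exp_pos _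
  have hlevel : ∀ k : ℕ, ((B.filter fun g => (cluster G V0 g v).card = k + 1).card : ℝ) ≤
      (1 / 8) ^ (k + 1) * (E * Ω.card) := by
    intro k
    set Bk := B.filter fun g => (cluster G V0 g v).card = k + 1 with hBk
    set codes := Bk.image (clusterCode G V0 v r) with hcodes
    set D : ℝ := ((3 * d ^ 2 : ℕ) : ℝ) with hD
    have hD1 : 1 ≤ D := by
      rw [hD]
      norm_cast
      have := pow_pos hd 2
      omega
    have hcodescard : (codes.card : ℝ) ≤ D ^ (2 * k) := by
      rw [hD]
      norm_cast
      refine card_connected_sets_le (heightNbrs G) ?_ (card_heightNbrs_le hG) (r, 0) k codes ?_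
      · intro a b hab
        rw [mem_heightNbrs] at hab ⊢
        obtain ⟨⟨w, h1, h2⟩, h3⟩ := hab
        exact ⟨⟨w, h2.symm, h1.symm⟩, by omega⟩
      · intro A hA
        obtain ⟨g, hg, rfl⟩ := mem_image.1 hA
        obtain ⟨hgB, hgk⟩ := mem_filter.1 hg
        obtain ⟨h1, h2, -⟩ := hBprop g hgB
        refine ⟨by rw [card_clusterCode, hgk], ?_, fun x hx =>
          clusterCode_connected hG h1.1 hr hx⟩
        exact mem_clusterCode.2 ⟨root_mem_cluster hG h1 h2 hr, by simp⟩
    have hfiber : ∀ C ∈ codes, ((Bk.filter fun g => clusterCode G V0 v r g = C).card : ℝ) ≤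
        E * Ω.card / (D ^ (2 * (k + 1)) * 8 ^ (k + 1)) := by
      intro C hC
      obtain ⟨g₀, hg₀, rfl⟩ := mem_image.1 hC
      obtain ⟨hg₀B, hg₀k⟩ := mem_filter.1 hg₀
      obtain ⟨h1, h2, h3⟩ := hBprop g₀ hg₀B
      set S := cluster G V0 g₀ v with hS
      have hSne : S.Nonempty := ⟨r, root_mem_cluster hG h1 h2 hr⟩
      have hent := exp_mul_pow_le_two_pow_mixedBoundary hG hconn hlam cluster_subset hSne
        (card_cluster_le hG hconn hlam' h1 h2)
      rw [← hD, hg₀k] at hent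
      have hball : ((gBall G v t).ncard : ℝ) ≤ (S ∪ nbhdIn G V1 S).card := by
        have := Set.ncard_le_ncard (gBall_subset_cluster hG hconn h1 h2 h3) (finite_toSet _)
        rw [Set.ncard_coe_finset] at this
        exact_mod_cast this
      have hEexp : 1 ≤ E * Real.exp (((S ∪ nbhdIn G V1 S).card : ℝ) / 3) := by
        rw [hE, ← Real.exp_add]
        exact Real.one_le_exp (by linarith)
      have hX : (0 : ℝ) < D ^ (2 * (k + 1)) * 8 ^ (k + 1) := by positivity
      have hX8 : (8 : ℝ) ≤ D ^ (2 * (k + 1)) * 8 ^ (k + 1) := by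
        have a1 : (1 : ℝ) ≤ D ^ (2 * (k + 1)) := one_le_pow₀ hD1
        have a2 : (8 : ℝ) ^ 1 ≤ 8 ^ (k + 1) := pow_le_pow_right₀ (by norm_num) (by omega)
        nlinarith
      have hMne : (mixedBoundary G V1 S).Nonempty := by
        rw [nonempty_iff_ne_empty]
        intro hM
        rw [hM, card_empty, pow_zero] at hent
        have : (1 : ℝ) ≤ Real.exp (((S ∪ nbhdIn G V1 S).card : ℝ) / 3) :=
          Real.one_le_exp (by positivity)
        nlinarith
      have hcount := card_fiber_mul_two_pow_le hG hconn hlam' (v := v) (r := r) (S := S)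
        (F := Bk.filter fun g => clusterCode G V0 v r g = clusterCode G V0 v r g₀)
        (C := clusterCode G V0 v r g₀) hΩ (by
          intro g hg
          obtain ⟨hgk, hgC⟩ := mem_filter.1 hg
          have hgB := (mem_filter.1 hgk).1
          exact ⟨(mem_filter.1 hgB).1, (hBprop g hgB).2.1, hgC,
            cluster_eq_of_clusterCode_eq hgC⟩) cluster_subset hMne
      set c := (Bk.filter fun g => clusterCode G V0 v r g = clusterCode G V0 v r g₀).card
      have hcount' : (c : ℝ) * 2 ^ (mixedBoundary G V1 S).card ≤ Ω.card := by
        exact_mod_cast hcount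
      rw [le_div_iff₀ hX]
      set X := D ^ (2 * (k + 1)) * 8 ^ (k + 1)
      set Y := Real.exp (((S ∪ nbhdIn G V1 S).card : ℝ) / 3)
      calc (c : ℝ) * X ≤ (E * Y) * (c * X) := le_mul_of_one_le_left (by positivity) hEexp
        _ = E * (c * (Y * X)) := by ring
        _ ≤ E * (c * 2 ^ (mixedBoundary G V1 S).card) := by gcongr
        _ ≤ E * Ω.card := by gcongr
    have hsum : (Bk.card : ℝ) =
        ∑ C ∈ codes, ((Bk.filter fun g => clusterCode G V0 v r g = C).card : ℝ) := by
      rw [card_eq_sum_card_fiberwise (f := clusterCode G V0 v r) (t := codes)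
        (fun g hg => mem_image_of_mem _ hg)]
      push_cast
      rfl
    rw [hsum]
    refine (sum_le_sum hfiber).trans ?_
    rw [sum_const, nsmul_eq_mul]
    have hDk : D ^ (2 * k) ≤ D ^ (2 * (k + 1)) := pow_le_pow_right₀ hD1 (by omega)
    have hcc := hcodescard.trans hDk
    have hDpos : 0 < D ^ (2 * (k + 1)) := by positivity
    calc (codes.card : ℝ) * (E * Ω.card / (D ^ (2 * (k + 1)) * 8 ^ (k + 1)))
        ≤ D ^ (2 * (k + 1)) * (E * Ω.card / (D ^ (2 * (k + 1)) * 8 ^ (k + 1))) := by gcongr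
      _ = (1 / 8) ^ (k + 1) * (E * Ω.card) := by
        rw [one_div, inv_pow]
        field_simp
  have htotal : (B.card : ℝ) = ∑ k ∈ range (Fintype.card V),
      ((B.filter fun g => (cluster G V0 g v).card = k + 1).card : ℝ) := by
    rw [card_eq_sum_card_fiberwise (f := fun g => (cluster G V0 g v).card - 1)
      (t := range (Fintype.card V))]
    · push_cast
      refine sum_congr rfl fun k _ => ?_
      congr 2
      refine filter_congr fun g hg => ?_
      obtain ⟨h1, h2, -⟩ := hBprop g hg
      have := card_pos.2 ⟨r, root_mem_cluster hG h1 h2 hr⟩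
      omega
    · intro g hg
      obtain ⟨h1, h2, -⟩ := hBprop g hg
      have := card_pos.2 ⟨r, root_mem_cluster hG h1 h2 hr⟩
      have := card_le_univ (cluster G V0 g v)
      simp only [coe_range, Set.mem_Iio]
      omega
  rw [htotal]
  refine (sum_le_sum fun k _ => hlevel k).trans ?_
  rw [← sum_mul]
  exact mul_le_mul_of_nonneg_right (sum_inv_eight_pow_le _) (by positivity)

/-- Normalizing at `v₀` embeds the ground height functions into `HomSet G v₀`. -/
theorem injOn_normalize_groundHeights (hG : IsBiExpander G V0 V1 n d lam) (hconn : G.Connected)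
    (hlam : lam ≤ d / 200) (v₀ : V) :
    Set.InjOn (fun (g : V → ℤ) v => g v - g v₀) (groundHeights G V0 (lam * n / d)) := by
  intro g hg g' hg' h
  have hn : (0 : ℝ) < n := by exact_mod_cast hG.n_pos hconn
  have hd : (0 : ℝ) < d := by exact_mod_cast hG.d_pos hconn
  have hδ1 : lam * n / d ≤ n / 200 := by
    rw [div_le_iff₀ hd]; nlinarith
  obtain ⟨x, -, h1, h2⟩ : ∃ x ∈ V0, g x = 0 ∧ g' x = 0 := by
    by_contra! hcon
    have : (V0.card : ℝ) ≤ (V0.filter fun v => g v ≠ 0).card +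
        (V0.filter fun v => g' v ≠ 0).card := by
      norm_cast
      refine (card_le_card fun v hv => ?_).trans (card_union_le _ _)
      rw [mem_union, mem_filter, mem_filter]
      by_cases h0 : g v = 0
      · exact Or.inr ⟨hv, hcon v hv h0⟩
      · exact Or.inl ⟨hv, h0⟩
    rw [hG.2.1] at this
    have := hg.2
    have := hg'.2
    linarith
  have hx := congrFun h x
  simp only [h1, h2] at hx
  funext v
  have hv := congrFun h v
  simp only at hv
  omega

theorem ncard_groundHeights_lt_le (hG : IsBiExpander G V0 V1 n d lam) (hconn : G.Connected)
    (hlam : lam ≤ (d : ℝ) / (300 * Real.log d)) (v₀ v : V) {t : ℕ} (ht : 1 ≤ t) :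
    {g ∈ groundHeights G V0 (lam * n / d) | (t : ℤ) < g v}.Finite ∧
    ({g ∈ groundHeights G V0 (lam * n / d) | (t : ℤ) < g v}.ncard : ℝ) ≤
      1 / 4 * (Real.exp (-((gBall G v t).ncard : ℝ) / 3) * (HomSet G v₀).ncard) := by
  have hlam' := lam_le_of_log hlam
  have hmaps : Set.MapsTo (fun (g : V → ℤ) v => g v - g v₀) (groundHeights G V0 (lam * n / d))
      (HomSet G v₀) := fun g hg => ⟨sub_self _, hg.1.sub_const _⟩
  have hinj := injOn_normalize_groundHeights hG hconn hlam' v₀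
  have hfin : (groundHeights G V0 (lam * n / d)).Finite :=
    Set.Finite.of_injOn hmaps hinj (finite_homSet hconn v₀)
  have hle := Set.ncard_le_ncard_of_injOn _ hmaps hinj (finite_homSet hconn v₀)
  have hmain := card_lt_height_le hG hconn hlam (Ω := hfin.toFinset) (by simp) v ht
  refine ⟨hfin.subset (Set.sep_subset _ _), ?_⟩
  have e : {g ∈ groundHeights G V0 (lam * n / d) | (t : ℤ) < g v} =
      ↑(hfin.toFinset.filter fun g => (t : ℤ) < g v) := by
    ext g; simp
  rw [e, Set.ncard_coe_finset]
  rw [Set.ncard_eq_toFinset_card _ hfin] at hle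
  refine hmain.trans ?_
  gcongr

end Counting

theorem stmt5 {V : Type*} [Fintype V] [DecidableEq V] (G : SimpleGraph V) [DecidableRel G.Adj]
    (V0 V1 : Finset V) (n d : ℕ) (lam : ℝ)
    (hconn : G.Connected) (hG : IsBiExpander G V0 V1 n d lam)
    (hlam : lam ≤ (d : ℝ) / (300 * Real.log d)) (v₀ : V) :
    ∃ Φ : (V → ℤ) → ℤ,
      (∀ f ∈ HomSet G v₀, ∃ W : Finset V, (W = V0 ∨ W = V1) ∧
        (((W.filter (fun v => f v ≠ Φ f)).card : ℝ)) ≤ 2 * lam * n / d ∧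
        ({v : V | 2 ≤ |f v - Φ f|}.ncard : ℝ) ≤ 3 * lam * n / d) ∧
      ∀ (v : V) (t : ℕ), 1 ≤ t →
        ({f ∈ HomSet G v₀ | (t : ℤ) < |f v - Φ f|}.ncard : ℝ) ≤
          Real.exp (-((gBall G v t).ncard : ℝ) / 3) * ((HomSet G v₀).ncard : ℝ) := by
  have hlam' := lam_le_of_log hlam
  have hex : ∀ f : V → ℤ, ∃ (W : Finset V) (c : ℤ), f ∈ HomSet G v₀ →
      (W = V0 ∨ W = V1) ∧ IsFlatAround f W c (lam * n / d) := by
    intro f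
    by_cases hf : f ∈ HomSet G v₀
    · obtain ⟨W, c, h⟩ := exists_isFlatAround hG hconn hlam' hf.2
      exact ⟨W, c, fun _ => h⟩
    · exact ⟨∅, 0, fun h => absurd h hf⟩
  choose W Φ hΦ using hex
  refine ⟨Φ, fun f hf => ⟨W f, (hΦ f hf).1, ?_, ?_⟩, fun v t ht => ?_⟩
  · refine (hΦ f hf).2.1.trans (le_of_eq (by ring))
  · have h := (hΦ f hf).2.2
    have e : {v : V | 2 ≤ |f v - Φ f|} = ↑(univ.filter fun v => 2 ≤ |f v - Φ f|) := by
      ext; simp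
    rw [e, Set.ncard_coe_finset]
    exact h.trans (le_of_eq (by ring))
  set E := Real.exp (-((gBall G v t).ncard : ℝ) / 3) * ((HomSet G v₀).ncard : ℝ) with hE
  have hclass : ∀ W' : Finset V, W' = V0 ∨ W' = V1 →
      {g ∈ groundHeights G W' (lam * n / d) | (t : ℤ) < g v}.Finite ∧
      ({g ∈ groundHeights G W' (lam * n / d) | (t : ℤ) < g v}.ncard : ℝ) ≤ 1 / 4 * E := by
    rintro W' (rfl | rfl)
    · exact ncard_groundHeights_lt_le hG hconn hlam v₀ v ht
    · exact ncard_groundHeights_lt_le hG.symm hconn hlam v₀ v ht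
  have hground : ∀ f ∈ HomSet G v₀, (fun u => f u - Φ f) ∈ groundHeights G (W f) (lam * n / d) ∧
      (fun u => Φ f - f u) ∈ groundHeights G (W f) (lam * n / d) := by
    intro f hf
    have h := (hΦ f hf).2.1
    refine ⟨⟨IsHeight.sub_const hf.2 _, ?_⟩, ⟨IsHeight.const_sub hf.2 _, ?_⟩⟩
    · simpa only [ne_eq, sub_eq_zero] using h
    · simpa only [ne_eq, sub_eq_zero, eq_comm] using h
  have hpos : ∀ W' : Finset V, W' = V0 ∨ W' = V1 →
      ({f ∈ HomSet G v₀ | W f = W' ∧ (t : ℤ) < f v - Φ f}.ncard : ℝ) ≤ 1 / 4 * E := by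
    intro W' hW'
    refine le_trans ?_ (hclass W' hW').2
    norm_cast
    refine Set.ncard_le_ncard_of_injOn (fun f u => f u - Φ f) ?_ ?_ (hclass W' hW').1
    · rintro f ⟨hf, rfl, hft⟩
      exact ⟨(hground f hf).1, hft⟩
    · rintro f ⟨hf, -⟩ f' ⟨hf', -⟩ h
      have h0 := congrFun h v₀
      simp only [hf.1, hf'.1] at h0
      funext u
      have hu := congrFun h u
      simp only at hu
      omega
  have hneg : ∀ W' : Finset V, W' = V0 ∨ W' = V1 →
      ({f ∈ HomSet G v₀ | W f = W' ∧ (t : ℤ) < Φ f - f v}.ncard : ℝ) ≤ 1 / 4 * E := by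
    intro W' hW'
    refine le_trans ?_ (hclass W' hW').2
    norm_cast
    refine Set.ncard_le_ncard_of_injOn (fun f u => Φ f - f u) ?_ ?_ (hclass W' hW').1
    · rintro f ⟨hf, rfl, hft⟩
      exact ⟨(hground f hf).2, hft⟩
    · rintro f ⟨hf, -⟩ f' ⟨hf', -⟩ h
      have h0 := congrFun h v₀
      simp only [hf.1, hf'.1] at h0
      funext u
      have hu := congrFun h u
      simp only at hu
      omega
  have hsub : {f ∈ HomSet G v₀ | (t : ℤ) < |f v - Φ f|} ⊆
      ({f ∈ HomSet G v₀ | W f = V0 ∧ (t : ℤ) < f v - Φ f} ∪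
        {f ∈ HomSet G v₀ | W f = V1 ∧ (t : ℤ) < f v - Φ f}) ∪
      ({f ∈ HomSet G v₀ | W f = V0 ∧ (t : ℤ) < Φ f - f v} ∪
        {f ∈ HomSet G v₀ | W f = V1 ∧ (t : ℤ) < Φ f - f v}) := by
    rintro f ⟨hf, hft⟩
    rcases lt_abs.1 hft with h | h <;> rcases (hΦ f hf).1 with hW | hW
    · exact Or.inl (Or.inl ⟨hf, hW, h⟩)
    · exact Or.inl (Or.inr ⟨hf, hW, h⟩)
    · exact Or.inr (Or.inl ⟨hf, hW, by omega⟩)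
    · exact Or.inr (Or.inr ⟨hf, hW, by omega⟩)
  have hfin := finite_homSet hconn v₀
  have hle := (Set.ncard_le_ncard hsub
    (((hfin.subset (Set.sep_subset _ _)).union (hfin.subset (Set.sep_subset _ _))).union
      ((hfin.subset (Set.sep_subset _ _)).union (hfin.subset (Set.sep_subset _ _))))).trans
    ((Set.ncard_union_le _ _).trans
      (Nat.add_le_add (Set.ncard_union_le _ _) (Set.ncard_union_le _ _)))
  have hle' := (Nat.cast_le (α := ℝ)).2 hle
  push_cast at hle'
  linarith [hpos V0 (Or.inl rfl), hpos V1 (Or.inr rfl), hneg V0 (Or.inl rfl),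
    hneg V1 (Or.inr rfl)]
end
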